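/- Let T be an LFC tiling of ℝ^e with e ≠ 2 such that every tile of T is combinatorially regular (i.e., for every tile F, the automorphism group of the interval [∅, F] of the face poset acts transitively on its maximal chains) and every vertex figure of T is combinatorially regular (i.e., for every vertex v, the automorphism group of the interval [v, 1̂] of the face poset, where 1̂ is the greatest element, acts transitively on its maximal chains). Then T is combinatorially regular: Γ(T) acts transitively on the flags of T. -/

import Mathlib

/-! Generic definitions about flags, flag orbits, and abstract polytopes. -/

variable {α : Type*} [PartialOrder α]

/-- Two flags (maximal chains) are in the same orbit of the automorphism group
(the group of order automorphisms) if some order automorphism maps one onto the other. -/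
def SameFlagOrbit (Φ Ψ : Flag α) : Prop :=
  ∃ γ : α ≃o α, γ '' (Φ : Set α) = (Ψ : Set α)

/-- The automorphism group has exactly two orbits on the flags. -/
def TwoFlagOrbits (α : Type*) [PartialOrder α] : Prop :=
  ∃ Φ Ψ : Flag α, ¬ SameFlagOrbit Φ Ψ ∧
    ∀ Ω : Flag α, SameFlagOrbit Ω Φ ∨ SameFlagOrbit Ω Ψ

/-- `Ψ` is the flag `Φ^i`: it differs from `Φ` in exactly the rank-`i` element
(with respect to the rank function `rk`). -/
def IsIAdjacent (rk : α → ℤ) (i : ℤ) (Φ Ψ : Flag α) : Prop :=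
  Φ ≠ Ψ ∧ ∀ x : α, rk x ≠ i → (x ∈ Φ ↔ x ∈ Ψ)

/-- A two-orbit polytope (with rank function `rk`, adjacency indices `0, …, n-1`)
is in class `2_I` if, for every flag `Φ` and every `i < n`, the `i`-adjacent flag `Φ^i`
lies in the same orbit as `Φ` exactly when `i ∈ I`. -/
def InClass (rk : α → ℤ) (n : ℕ) (I : Set ℕ) : Prop :=
  TwoFlagOrbits α ∧
    ∀ (Φ Ψ : Flag α) (i : ℕ), i < n → IsIAdjacent rk i Φ Ψ →
      (SameFlagOrbit Φ Ψ ↔ i ∈ I)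

/-- An abstract polytope of rank `d`: a bounded poset, graded by a rank function `rk`
taking values `-1, 0, …, d`, in which every flag (maximal chain) has exactly one element
of each rank, satisfying the diamond condition and strong flag-connectivity. -/
structure IsAbstractPolytope (α : Type*) [PartialOrder α] [BoundedOrder α]
    (rk : α → ℤ) (d : ℕ) : Prop where
  rk_bot : rk ⊥ = -1
  rk_top : rk ⊤ = d
  rk_strictMono : StrictMono rk
  rk_cover : ∀ x y : α, x ⋖ y → rk y = rk x + 1
  flag_ranks : ∀ (Φ : Flag α) (i : ℤ), -1 ≤ i → i ≤ d → ∃! x, x ∈ Φ ∧ rk x = i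
  diamond : ∀ x y : α, x < y → rk y = rk x + 2 →
    ∃ a b : α, a ≠ b ∧ ∀ z : α, (x < z ∧ z < y) ↔ (z = a ∨ z = b)
  connected : ∀ Φ Ψ : Flag α, ∃ (n : ℕ) (c : Fin (n + 1) → Flag α),
    c 0 = Φ ∧ c (Fin.last n) = Ψ ∧
    (∀ k : Fin n, ∃ i : ℤ, IsIAdjacent rk i (c k.castSucc) (c k.succ)) ∧
    (∀ k, (Φ : Set α) ∩ (Ψ : Set α) ⊆ (c k : Set α))
/-! Definitions about convex polytopes and their face lattices. -/

/-- Euclidean `d`-space. -/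
abbrev EucSp (d : ℕ) : Type := EuclideanSpace ℝ (Fin d)

/-- A convex `d`-polytope: the convex hull of a finite set of points of `ℝ^d`,
with nonempty interior. -/
def IsConvexPolytope {d : ℕ} (P : Set (EucSp d)) : Prop :=
  (∃ S : Finset (EucSp d), P = convexHull ℝ (S : Set (EucSp d))) ∧ (interior P).Nonempty

/-- The face lattice of `P`: the exposed faces of `P` (intersections of `P` with supporting
hyperplanes, together with `∅` and `P` itself), ordered by inclusion. -/
def Faces {d : ℕ} (P : Set (EucSp d)) : Type := {F : Set (EucSp d) // IsExposed ℝ P F}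

noncomputable instance {d : ℕ} (P : Set (EucSp d)) : PartialOrder (Faces P) :=
  Subtype.partialOrder _

open scoped Classical

/-- The rank of a face: `-1` for the empty face, and otherwise its affine dimension. -/
noncomputable def faceRank {d : ℕ} {P : Set (EucSp d)} (F : Faces P) : ℤ :=
  if F.1 = ∅ then -1
  else (Module.finrank ℝ (affineSpan ℝ F.1).direction : ℤ)
/-! Definitions about locally finite face-to-face tilings of Euclidean space by convex
polytopes (LFC tilings) and their face posets. -/

/-- An LFC tiling of `ℝ^d`: a face-to-face, locally finite tiling of `ℝ^d` by convex
`d`-polytopes. -/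
structure IsLFCTiling {d : ℕ} (T : Set (Set (EucSp d))) : Prop where
  /-- Every tile is a convex `d`-polytope. -/
  polytope : ∀ t ∈ T, IsConvexPolytope t
  /-- The tiles cover all of `ℝ^d`. -/
  covers : ⋃₀ T = Set.univ
  /-- The tiling is face-to-face: the intersection of any two tiles is a
  (possibly empty) face of each. -/
  face_to_face : ∀ t ∈ T, ∀ s ∈ T, IsExposed ℝ t (t ∩ s) ∧ IsExposed ℝ s (t ∩ s)
  /-- The tiling is locally finite: every bounded set meets only finitely many tiles. -/
  locally_finite : ∀ B : Set (EucSp d), Bornology.IsBounded B →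
    {t ∈ T | (t ∩ B).Nonempty}.Finite

/-- The faces of the tiling `T`: all faces of all tiles (the empty face included). -/
def TFace {d : ℕ} (T : Set (Set (EucSp d))) : Type :=
  {F : Set (EucSp d) // ∃ t ∈ T, IsExposed ℝ t F}

noncomputable instance {d : ℕ} (T : Set (Set (EucSp d))) : PartialOrder (TFace T) :=
  Subtype.partialOrder _

/-- The face poset of the tiling `T`: all faces of all tiles, together with a greatest
element, ordered by inclusion.  It is an abstract polytope of rank `d + 1`. -/
abbrev TPoset {d : ℕ} (T : Set (Set (EucSp d))) : Type := WithTop (TFace T)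

/-- The rank of a subset of `ℝ^d` regarded as a face: `-1` for the empty face, and
otherwise its affine dimension. -/
noncomputable def setRank {d : ℕ} (F : Set (EucSp d)) : ℤ :=
  if F = ∅ then -1 else (Module.finrank ℝ (affineSpan ℝ F).direction : ℤ)

/-- The rank function of the face poset of a tiling of `ℝ^d`: faces get their affine
dimension (`-1` for the empty face), and the greatest element gets rank `d + 1`. -/
noncomputable def tileRank {d : ℕ} (T : Set (Set (EucSp d))) : TPoset T → ℤ :=
  WithTop.recTopCoe ((d : ℤ) + 1) (fun F => setRank F.1)

/-- A tiling is normal if its tiles are uniformly bounded: for some `u, U > 0`, every tile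
contains a ball of radius `u` and is contained in a ball of radius `U`. -/
def IsNormalTiling {d : ℕ} (T : Set (Set (EucSp d))) : Prop :=
  ∃ u U : ℝ, 0 < u ∧ 0 < U ∧ ∀ t ∈ T,
    (∃ x, Metric.closedBall x u ⊆ t) ∧ (∃ x, t ⊆ Metric.closedBall x U)
/-- A poset is maximal-chain-transitive if its group of order automorphisms acts
transitively on its maximal chains. -/
def MaxChainTransitive (β : Type*) [PartialOrder β] : Prop :=
  ∀ Φ Ψ : Flag β, ∃ γ : β ≃o β, γ '' (Φ : Set β) = (Ψ : Set β)

open scoped Classical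

namespace LFC

section Convexity

variable {e : ℕ}

/-- The algebraic relative interior of a set. -/
def core (F : Set (EucSp e)) : Set (EucSp e) :=
  {x | x ∈ F ∧ ∀ y ∈ F, ∃ ε : ℝ, 0 < ε ∧ x + ε • (x - y) ∈ F}

lemma mem_openSegment_ext (x y : EucSp e) {ε : ℝ} (hε : 0 < ε) :
    x ∈ openSegment ℝ y (x + ε • (x - y)) := by
  refine ⟨ε / (1 + ε), 1 / (1 + ε), by positivity, by positivity, by field_simp; ring, ?_⟩
  have h : (1 + ε) ≠ 0 := by positivity
  have h1 : (ε / (1 + ε)) • y + (1 / (1 + ε)) • (x + ε • (x - y))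
      = ((1 + ε) / (1 + ε)) • x := by
    module
  rw [h1, div_self h, one_smul]

lemma shrink {F : Set (EucSp e)} (hF : Convex ℝ F) {x d : EucSp e} (hx : x ∈ F) {ε δ : ℝ}
    (h : x + ε • d ∈ F) (hδ : 0 ≤ δ) (hδε : δ ≤ ε) : x + δ • d ∈ F := by
  rcases hδ.eq_or_lt with h0 | h0
  · simpa [← h0] using hx
  have hε : 0 < ε := h0.trans_le hδε
  have := hF hx h (a := 1 - δ / ε) (b := δ / ε)
    (by rw [sub_nonneg, div_le_one hε]; exact hδε) (by positivity) (by ring)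
  convert this using 1
  have h1 : δ = δ / ε * ε := by field_simp
  conv_lhs => rw [h1]
  module

lemma core_combo {F : Set (EucSp e)} (hF : Convex ℝ F) {b z : EucSp e} (hb : b ∈ core F)
    (hz : z ∈ F) {a : ℝ} (ha : 0 < a) (ha1 : a ≤ 1) : a • b + (1 - a) • z ∈ core F := by
  refine ⟨hF hb.1 hz ha.le (by linarith) (by ring), fun y hy => ?_⟩
  obtain ⟨ε, hε, h⟩ := hb.2 y hy
  obtain ⟨α, hα, rfl⟩ : ∃ α : ℝ, 0 < α ∧ a = α * (1 + ε) :=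
    ⟨a / (1 + ε), by positivity, by field_simp⟩
  refine ⟨α * ε, by positivity, ?_⟩
  have h3 := hF.sum_mem (t := (Finset.univ : Finset (Fin 3)))
    (w := ![α, α * ε * (α * (1 + ε)), (1 + α * ε) * (1 - α * (1 + ε))])
    (z := ![b + ε • (b - y), b, z])
    (by
      intro i _
      fin_cases i
      · exact hα.le
      · show 0 ≤ α * ε * (α * (1 + ε))
        positivity
      · show 0 ≤ (1 + α * ε) * (1 - α * (1 + ε))
        have : 0 ≤ 1 - α * (1 + ε) := by linarith
        positivity)
    (by simp [Fin.sum_univ_three]; ring)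
    (by
      intro i _
      fin_cases i
      · exact h
      · exact hb.1
      · exact hz)
  convert h3 using 1
  simp only [Fin.sum_univ_three, Matrix.cons_val_zero, Matrix.cons_val_one, Matrix.cons_val]
  module

lemma core_nonempty {S : Finset (EucSp e)} (hS : S.Nonempty) :
    (core (convexHull ℝ (S : Set (EucSp e)))).Nonempty := by
  have hn : 0 < (S.card : ℝ) := by exact_mod_cast hS.card_pos
  refine ⟨∑ s ∈ S, (1 / (S.card : ℝ)) • s, ?_, ?_⟩
  · rw [Finset.mem_convexHull']
    exact ⟨fun _ => 1 / (S.card : ℝ), fun _ _ => by positivity, by simp; field_simp, rfl⟩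
  · intro y hy
    rw [Finset.mem_convexHull'] at hy
    obtain ⟨w, hw0, hw1, hw⟩ := hy
    refine ⟨1 / S.card, by positivity, ?_⟩
    rw [Finset.mem_convexHull']
    refine ⟨fun s => (1 + 1 / S.card) * (1 / S.card) - 1 / S.card * w s, ?_, ?_, ?_⟩
    · intro s hs
      have : w s ≤ 1 := by rw [← hw1]; exact Finset.single_le_sum (f := w) hw0 hs
      have h2 : 0 ≤ (1 / S.card : ℝ) := by positivity
      nlinarith
    · rw [Finset.sum_sub_distrib, ← Finset.mul_sum, ← Finset.mul_sum, hw1]; simp; field_simp; ring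
    · rw [← hw]
      simp only [sub_smul, Finset.sum_sub_distrib, mul_smul, ← Finset.smul_sum]
      module

lemma core_dir {F : Set (EucSp e)} (hF : Convex ℝ F) {x f : EucSp e} (hx : x ∈ core F)
    (hf : f ∈ affineSpan ℝ F) : ∃ ε : ℝ, 0 < ε ∧ x + ε • (x - f) ∈ F := by
  let D : Submodule ℝ (EucSp e) :=
    { carrier := {d | ∃ ε : ℝ, 0 < ε ∧ x + ε • d ∈ F}
      zero_mem' := ⟨1, one_pos, by simpa using hx.1⟩
      add_mem' := by
        rintro a b ⟨ε, hε, h⟩ ⟨δ, hδ, h'⟩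
        refine ⟨min ε δ / 2, by positivity, ?_⟩
        have h1 := shrink hF hx.1 h (δ := min ε δ) (by positivity) (min_le_left _ _)
        have h2 := shrink hF hx.1 h' (δ := min ε δ) (by positivity) (min_le_right _ _)
        have := hF h1 h2 (a := 1 / 2) (b := 1 / 2) (by norm_num) (by norm_num) (by norm_num)
        convert this using 1
        module
      smul_mem' := by
        rintro c d ⟨ε, hε, h⟩
        rcases lt_trichotomy c 0 with hc | hc | hc
        · obtain ⟨δ, hδ, h'⟩ := hx.2 _ h
          refine ⟨δ * ε / (-c), div_pos (by positivity) (by linarith), ?_⟩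
          convert h' using 2
          have : (δ * ε / (-c)) * c = - (δ * ε) := by
            have : c ≠ 0 := hc.ne
            field_simp
          rw [smul_smul, this]
          module
        · subst hc
          exact ⟨1, one_pos, by simpa using hx.1⟩
        · refine ⟨ε / c, by positivity, ?_⟩
          rwa [smul_smul, div_mul_cancel₀ _ hc.ne'] }
  have hle : vectorSpan ℝ F ≤ D := by
    rw [vectorSpan_eq_span_vsub_set_right ℝ hx.1, Submodule.span_le]
    rintro _ ⟨y, hy, rfl⟩
    exact ⟨1, one_pos, by simpa using hy⟩
  have : x - f ∈ vectorSpan ℝ F := by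
    rw [← direction_affineSpan]
    exact AffineSubspace.vsub_mem_direction (subset_affineSpan ℝ F hx.1) hf
  exact hle this

/-- The smallest extreme subset of `t` containing `x`. -/
def ext (t : Set (EucSp e)) (x : EucSp e) : Set (EucSp e) :=
  {y | y ∈ t ∧ ∃ ε : ℝ, 0 < ε ∧ x + ε • (x - y) ∈ t}

lemma mem_ext_self {t : Set (EucSp e)} {x : EucSp e} (hx : x ∈ t) : x ∈ ext t x :=
  ⟨hx, 1, one_pos, by simpa using hx⟩

lemma convex_ext {t : Set (EucSp e)} (ht : Convex ℝ t) {x : EucSp e} (hx : x ∈ t) :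
    Convex ℝ (ext t x) := by
  rintro y ⟨hy, ε, hε, h⟩ z ⟨hz, δ, hδ, h'⟩ a b ha hb hab
  refine ⟨ht hy hz ha hb hab, min ε δ, by positivity, ?_⟩
  have h1 := shrink ht hx h (δ := min ε δ) (by positivity) (min_le_left _ _)
  have h2 := shrink ht hx h' (δ := min ε δ) (by positivity) (min_le_right _ _)
  convert ht h1 h2 ha hb hab using 1
  have : b = 1 - a := by linarith
  subst this
  module

lemma core_ext {t : Set (EucSp e)} (ht : Convex ℝ t) {x : EucSp e} (hx : x ∈ t) :
    x ∈ core (ext t x) := by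
  refine ⟨mem_ext_self hx, ?_⟩
  rintro y ⟨hy, ε, hε, h⟩
  refine ⟨ε, hε, h, 1 / ε, by positivity, ?_⟩
  convert hy using 1
  have : (1 / ε) * ε = 1 := by field_simp
  rw [sub_add_cancel_left, smul_neg, smul_smul, this]
  module

lemma mem_of_core_of_extreme {t G F : Set (EucSp e)} (hG : IsExtreme ℝ t G) (hFt : F ⊆ t)
    {x : EucSp e} (hxF : x ∈ core F) (hxG : x ∈ G) : F ⊆ G := by
  intro y hy
  obtain ⟨ε, hε, h⟩ := hxF.2 y hy
  exact hG.left_mem_of_mem_openSegment (hFt hy) (hFt h) hxG (mem_openSegment_ext x y hε)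

lemma exposed_eq_hull {S : Finset (EucSp e)} {F : Set (EucSp e)}
    (hF : IsExposed ℝ (convexHull ℝ (S : Set (EucSp e))) F) :
    F = convexHull ℝ ((S : Set (EucSp e)) ∩ F) := by
  have hc : IsCompact (convexHull ℝ (S : Set (EucSp e))) := S.finite_toSet.isCompact_convexHull (𝕜 := ℝ)
  have hFc := hF.isCompact hc
  have hFconv := hF.convex (convex_convexHull ℝ _)
  apply Set.Subset.antisymm
  · have h1 := closure_convexHull_extremePoints hFc hFconv
    have h2 : F.extremePoints ℝ ⊆ (S : Set (EucSp e)) ∩ F := by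
      intro x hx
      refine ⟨?_, hx.1⟩
      exact extremePoints_convexHull_subset (hF.isExtreme.extremePoints_subset_extremePoints hx)
    have h3 : IsClosed (convexHull ℝ ((S : Set (EucSp e)) ∩ F)) :=
      ((S.finite_toSet.inter_of_left F).isCompact_convexHull (𝕜 := ℝ)).isClosed
    refine h1.symm.subset.trans ?_
    exact closure_minimal (convexHull_mono h2) h3
  · exact convexHull_min Set.inter_subset_right hFconv

lemma finite_exposed (S : Finset (EucSp e)) :
    {F | IsExposed ℝ (convexHull ℝ (S : Set (EucSp e))) F}.Finite := by
  refine ((S.finite_toSet.finite_subsets).image (fun A => convexHull ℝ A)).subset ?_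
  intro F hF
  exact ⟨_, Set.inter_subset_left, (exposed_eq_hull hF).symm⟩

lemma exposed_ext {S : Finset (EucSp e)} {x : EucSp e}
    (hx : x ∈ convexHull ℝ (S : Set (EucSp e))) :
    IsExposed ℝ (convexHull ℝ (S : Set (EucSp e))) (ext (convexHull ℝ (S : Set (EucSp e))) x) := by
  set t := convexHull ℝ (S : Set (EucSp e)) with ht
  have htc : Convex ℝ t := convex_convexHull ℝ _
  set X := ext t x with hX
  have hXc : Convex ℝ X := convex_ext htc hx
  have hxX : x ∈ core X := core_ext htc hx
  have hWt : ∀ f ∈ t, f ∈ affineSpan ℝ X → f ∈ X := by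
    intro f hf hfX
    obtain ⟨ε, hε, h⟩ := core_dir hXc hxX hfX
    exact ⟨hf, ε, hε, h.1⟩
  have hext : ∀ y ∈ t, ∀ z ∈ t, ∀ u ∈ X, u ∈ openSegment ℝ y z → y ∈ X := by
    rintro y hy z hz u ⟨hu, ε, hε, h⟩ ⟨a, b, ha, hb, hab, rfl⟩
    refine ⟨hy, ε * a / (1 + ε * b), by positivity, ?_⟩
    have hd : 0 < 1 + ε * b := by positivity
    have h4 := htc h hz (a := 1 / (1 + ε * b)) (b := ε * b / (1 + ε * b)) (by positivity)
      (by positivity) (by field_simp)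
    convert h4 using 1
    have hb' : b = 1 - a := by linarith
    have e1 : (1 / (1 + ε * b)) * (1 + ε) = 1 + ε * a / (1 + ε * b) := by
      field_simp
      rw [hb']; ring
    have e2 : (1 / (1 + ε * b)) • (x + ε • (x - (a • y + b • z))) =
      ((1 / (1 + ε * b)) * (1 + ε)) • x - (ε * a / (1 + ε * b)) • y - (ε * b / (1 + ε * b)) • z := by
      module
    rw [e2, e1]
    module
  have hcompl : Convex ℝ (t \ X) := by
    rw [convex_iff_openSegment_subset]
    intro y hy z hz u hu
    exact ⟨htc.openSegment_subset hy.1 hz.1 hu, fun huX => hy.2 (hext y hy.1 z hz.1 u huX hu)⟩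
  set K := convexHull ℝ ((S : Set (EucSp e)) \ X) with hK
  have hKt : K ⊆ t \ X := convexHull_min
    (fun s hs => ⟨subset_convexHull ℝ _ hs.1, hs.2⟩) hcompl
  have hKcomp : IsCompact K := (S.finite_toSet.sdiff).isCompact_convexHull (𝕜 := ℝ)
  obtain ⟨l, u, v, h1, huv, h2⟩ := geometric_hahn_banach_compact_closed
    (convex_convexHull ℝ _) hKcomp (AffineSubspace.convex (affineSpan ℝ X))
    (AffineSubspace.closed_of_finiteDimensional (affineSpan ℝ X))
    (Set.disjoint_left.2 fun y hy hy' => (hKt hy).2 (hWt y (hKt hy).1 hy'))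
  have hconst : ∀ f ∈ affineSpan ℝ X, l f = l x := by
    intro f hf
    by_contra hne
    have hxs := subset_affineSpan ℝ X hxX.1
    have hne' : l f - l x ≠ 0 := sub_ne_zero.2 hne
    have := h2 (AffineMap.lineMap x f ((v - l x) / (l f - l x)))
      (AffineMap.lineMap_mem _ hxs hf)
    rw [AffineMap.lineMap_apply] at this
    simp only [vsub_eq_sub, vadd_eq_add, map_add, map_smul, map_sub, smul_eq_mul] at this
    rw [div_mul_cancel₀ _ hne'] at this
    linarith
  have hS : ∀ s ∈ S, l s ≤ l x ∧ (l s = l x → s ∈ X) := by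
    intro s hs
    by_cases hsX : s ∈ X
    · exact ⟨(hconst s (subset_affineSpan ℝ X hsX)).le, fun _ => hsX⟩
    · have := h1 s (subset_convexHull ℝ _ ⟨hs, hsX⟩)
      have h3 := h2 x (subset_affineSpan ℝ X hxX.1)
      exact ⟨by linarith, fun h => by linarith⟩
  have hmax : ∀ y ∈ t, l y ≤ l x := by
    have : t ⊆ {y | l y ≤ l x} := convexHull_min (fun s hs => (hS s hs).1)
      (convex_halfSpace_le l.isLinear _)
    exact this
  intro _
  refine ⟨l, ?_⟩
  have hexp : IsExposed ℝ t {z ∈ t | ∀ y ∈ t, l y ≤ l z} := fun _ => ⟨l, rfl⟩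
  apply Set.Subset.antisymm
  · intro y hy
    refine ⟨hy.1, fun z hz => ?_⟩
    rw [hconst y (subset_affineSpan ℝ X hy)]
    exact hmax z hz
  · rw [exposed_eq_hull hexp]
    refine convexHull_min ?_ hXc
    rintro s ⟨hs, hs1, hs2⟩
    exact (hS s hs).2 (le_antisymm (hS s hs).1 (hs2 x hx))

end Convexity

end LFC

open scoped Classical

namespace LFC

section Tiling

variable {e : ℕ} {T : Set (Set (EucSp e))}

/-- Nonempty faces of the tiling. -/
def NF (T : Set (Set (EucSp e))) : Type := {F : TFace T // F.1.Nonempty}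

noncomputable instance : PartialOrder (NF T) := Subtype.partialOrder _

/-- The underlying set of a nonempty face. -/
def NF.s (F : NF T) : Set (EucSp e) := F.1.1

lemma NF.le_iff (F G : NF T) : F ≤ G ↔ F.s ⊆ G.s := Iff.rfl

lemma NF.ext_s {F G : NF T} (h : F.s = G.s) : F = G := Subtype.ext (Subtype.ext h)

lemma NF.nonempty (F : NF T) : F.s.Nonempty := F.2

lemma NF.exists_tile (F : NF T) : ∃ t ∈ T, IsExposed ℝ t F.s := F.1.2

/-- Build a nonempty face from a face of a tile. -/
def NF.mk' {t F : Set (EucSp e)} (ht : t ∈ T) (hF : IsExposed ℝ t F) (hn : F.Nonempty) : NF T :=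
  ⟨⟨F, t, ht, hF⟩, hn⟩

lemma NF.mk'_s {t F : Set (EucSp e)} (ht : t ∈ T) (hF : IsExposed ℝ t F) (hn : F.Nonempty) :
    (NF.mk' ht hF hn).s = F := rfl

lemma tile_hull (hT : IsLFCTiling T) {t : Set (EucSp e)} (ht : t ∈ T) :
    ∃ S : Finset (EucSp e), t = convexHull ℝ (S : Set (EucSp e)) := (hT.polytope t ht).1

lemma tile_convex (hT : IsLFCTiling T) {t : Set (EucSp e)} (ht : t ∈ T) : Convex ℝ t := by
  obtain ⟨S, rfl⟩ := tile_hull hT ht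
  exact convex_convexHull ℝ _

lemma tile_compact (hT : IsLFCTiling T) {t : Set (EucSp e)} (ht : t ∈ T) : IsCompact t := by
  obtain ⟨S, rfl⟩ := tile_hull hT ht
  exact S.finite_toSet.isCompact_convexHull (𝕜 := ℝ)

lemma face_convex (hT : IsLFCTiling T) (F : NF T) : Convex ℝ F.s := by
  obtain ⟨t, ht, h⟩ := F.exists_tile
  exact h.convex (tile_convex hT ht)

lemma face_compact (hT : IsLFCTiling T) (F : NF T) : IsCompact F.s := by
  obtain ⟨t, ht, h⟩ := F.exists_tile
  exact h.isCompact (tile_compact hT ht)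

lemma core_sub (hT : IsLFCTiling T) {F G : NF T} {x : EucSp e} (hF : x ∈ core F.s) (hG : x ∈ G.s) : F ≤ G := by
  obtain ⟨t, ht, h⟩ := F.exists_tile
  obtain ⟨u, hu, h'⟩ := G.exists_tile
  have h1 : F.s ⊆ t ∩ u := mem_of_core_of_extreme (hT.face_to_face t ht u hu).1.isExtreme
    h.subset hF ⟨h.subset hF.1, h'.subset hG⟩
  exact mem_of_core_of_extreme h'.isExtreme (fun y hy => (h1 hy).2) hF hG

lemma core_unique (hT : IsLFCTiling T) {F G : NF T} {x : EucSp e} (hF : x ∈ core F.s) (hG : x ∈ core G.s) : F = G :=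
  le_antisymm (core_sub hT hF hG.1) (core_sub hT hG hF.1)

lemma exists_car_tile (hT : IsLFCTiling T) {t : Set (EucSp e)} (ht : t ∈ T) {x : EucSp e} (hx : x ∈ t) :
    ∃ F : NF T, IsExposed ℝ t F.s ∧ x ∈ core F.s := by
  have htc := tile_convex hT ht
  have hexp : IsExposed ℝ t (ext t x) := by
    obtain ⟨S, rfl⟩ := tile_hull hT ht
    exact exposed_ext hx
  exact ⟨NF.mk' ht hexp ⟨x, mem_ext_self hx⟩, hexp, core_ext htc hx⟩

lemma exists_tile_mem (hT : IsLFCTiling T) (x : EucSp e) : ∃ t ∈ T, x ∈ t := by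
  have : x ∈ ⋃₀ T := by rw [hT.covers]; trivial
  simpa using this

lemma exists_car (hT : IsLFCTiling T) (x : EucSp e) : ∃ F : NF T, x ∈ core F.s := by
  obtain ⟨t, ht, hx⟩ := exists_tile_mem hT x
  obtain ⟨F, -, h⟩ := exists_car_tile hT ht hx
  exact ⟨F, h⟩

lemma face_core_nonempty (hT : IsLFCTiling T) (F : NF T) : (core F.s).Nonempty := by
  obtain ⟨t, ht, h⟩ := F.exists_tile
  obtain ⟨S, rfl⟩ := tile_hull hT ht
  have h1 := exposed_eq_hull h
  have hfin := S.finite_toSet.inter_of_left F.s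
  rw [h1, ← hfin.coe_toFinset]
  apply core_nonempty
  rw [Set.Finite.toFinset_nonempty]
  by_contra hne
  rw [Set.not_nonempty_iff_eq_empty] at hne
  rw [hne, convexHull_empty] at h1
  exact F.nonempty.ne_empty h1

lemma exposed_of_subset (hT : IsLFCTiling T) {F : NF T} {t : Set (EucSp e)} (ht : t ∈ T) (hF : F.s ⊆ t) :
    IsExposed ℝ t F.s := by
  obtain ⟨x, hx⟩ := face_core_nonempty hT F
  obtain ⟨G, hG, hxG⟩ := exists_car_tile hT ht (hF hx.1)
  rwa [core_unique hT hx hxG]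

/-- The dimension of a face. -/
noncomputable def rk (F : NF T) : ℕ := Module.finrank ℝ (affineSpan ℝ F.s).direction

lemma rk_le (F : NF T) : rk F ≤ e := by
  have := Submodule.finrank_le (affineSpan ℝ F.s).direction
  simpa [rk] using this

lemma rk_strictMono (hT : IsLFCTiling T) : StrictMono (rk : NF T → ℕ) := by
  intro F G hFG
  have hle : F.s ⊆ G.s := hFG.le
  by_contra hcon
  obtain ⟨x, hx⟩ := face_core_nonempty hT F
  have hmono : affineSpan ℝ F.s ≤ affineSpan ℝ G.s := affineSpan_mono ℝ hle
  have hd : (affineSpan ℝ F.s).direction = (affineSpan ℝ G.s).direction :=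
    Submodule.eq_of_le_of_finrank_le (AffineSubspace.direction_le hmono) (not_lt.1 hcon)
  have heq : affineSpan ℝ F.s = affineSpan ℝ G.s :=
    AffineSubspace.eq_of_direction_eq_of_nonempty_of_le hd
      ⟨x, subset_affineSpan ℝ _ hx.1⟩ hmono
  obtain ⟨t, ht, hGt⟩ := G.exists_tile
  have hFt := exposed_of_subset hT ht (hle.trans hGt.subset)
  apply hFG.not_ge
  intro g hg
  have hg' : g ∈ affineSpan ℝ F.s := by rw [heq]; exact subset_affineSpan ℝ _ hg
  obtain ⟨ε, hε, h⟩ := core_dir (face_convex hT F) hx hg'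
  exact hFt.isExtreme.left_mem_of_mem_openSegment (hGt.subset hg) (hFt.subset h) hx.1
    (mem_openSegment_ext x g hε)

lemma finite_faces_tile (hT : IsLFCTiling T) {t : Set (EucSp e)} (ht : t ∈ T) : {F : NF T | F.s ⊆ t}.Finite := by
  obtain ⟨S, hS⟩ := tile_hull hT ht
  refine Set.Finite.of_finite_image (f := NF.s) ((finite_exposed S).subset ?_) ?_
  · rintro _ ⟨F, hF, rfl⟩
    have := exposed_of_subset hT ht hF
    rwa [hS] at this
  · intro F _ G _ h
    exact NF.ext_s h

lemma locally_finite_faces (hT : IsLFCTiling T) {B : Set (EucSp e)} (hB : Bornology.IsBounded B) :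
    {F : NF T | ∃ t ∈ T, F.s ⊆ t ∧ (t ∩ B).Nonempty}.Finite := by
  refine ((hT.locally_finite B hB).biUnion (t := fun t => {F : NF T | F.s ⊆ t ∧ t ∈ T})
    (fun t ht => (finite_faces_tile hT ht.1).subset fun F hF => hF.1)).subset ?_
  rintro F ⟨t, ht, hF, hne⟩
  simp only [Set.mem_iUnion]
  exact ⟨t, ⟨ht, hne⟩, hF, ht⟩

lemma countable_NF (hT : IsLFCTiling T) : Countable (NF T) := by
  rw [← Set.countable_univ_iff]
  refine (Set.countable_iUnion fun n : ℕ =>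
    (locally_finite_faces hT (Metric.isBounded_closedBall (x := (0 : EucSp e)) (r := n))).countable).mono ?_
  intro F _
  obtain ⟨x, hx⟩ := F.nonempty
  obtain ⟨t, ht, hF⟩ := F.exists_tile
  obtain ⟨n, hn⟩ := exists_nat_ge ‖x‖
  rw [Set.mem_iUnion]
  exact ⟨n, t, ht, hF.subset, x, hF.subset hx, by simpa using hn⟩

end Tiling

end LFC

open scoped Classical
open scoped Topology

namespace LFC

section Rep

variable {e : ℕ} {V : Type*} [PartialOrder V]

/-- Total mass of a weight function. -/
noncomputable def mass (w : V →₀ ℝ) : ℝ := Finsupp.linearCombination ℝ (fun _ : V => (1 : ℝ)) w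

lemma mass_add (w v : V →₀ ℝ) : mass (w + v) = mass w + mass v := map_add _ _ _
lemma mass_sub (w v : V →₀ ℝ) : mass (w - v) = mass w - mass v := map_sub _ _ _
lemma mass_smul (c : ℝ) (w : V →₀ ℝ) : mass (c • w) = c * mass w := map_smul _ _ _
lemma mass_single (F : V) (c : ℝ) : mass (Finsupp.single F c) = c := by
  simp [mass]
lemma mass_eq_sum (w : V →₀ ℝ) : mass w = ∑ F ∈ w.support, w F := by
  simp [mass, Finsupp.linearCombination_apply, Finsupp.sum]

lemma mass_nonneg {w : V →₀ ℝ} (hw : ∀ F, 0 ≤ w F) : 0 ≤ mass w := by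
  rw [mass_eq_sum]
  exact Finset.sum_nonneg fun F _ => hw F

lemma eq_zero_of_mass {w : V →₀ ℝ} (hw : ∀ F, 0 ≤ w F) (h : mass w = 0) : w = 0 := by
  rw [mass_eq_sum, Finset.sum_eq_zero_iff_of_nonneg (fun F _ => hw F)] at h
  ext F
  by_cases hF : F ∈ w.support
  · exact h F hF
  · simpa using hF

/-- `w` is a system of barycentric coordinates of `x` supported on a chain. -/
structure IsRep (b : V → EucSp e) (w : V →₀ ℝ) (x : EucSp e) : Prop where
  nonneg : ∀ F, 0 ≤ w F
  chain : IsChain (· ≤ ·) (w.support : Set V)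
  mass_one : mass w = 1
  sum_eq : Finsupp.linearCombination ℝ b w = x

lemma exists_top {C : Finset V} (hC : IsChain (· ≤ ·) (C : Set V)) (hne : C.Nonempty) :
    ∃ F ∈ C, ∀ G ∈ C, G ≤ F := by
  obtain ⟨F, hF⟩ := C.exists_maximal hne
  refine ⟨F, hF.1, fun G hG => ?_⟩
  rcases hC.total hG hF.1 with h | h
  · exact h
  · exact hF.2 hG h

end Rep

section Tiling

variable {e : ℕ} {T : Set (Set (EucSp e))}

/-- A chosen point in the relative interior of each face. -/
noncomputable def bc (hT : IsLFCTiling T) (F : NF T) : EucSp e := (face_core_nonempty hT F).choose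

lemma bc_mem (hT : IsLFCTiling T) (F : NF T) : bc hT F ∈ core F.s :=
  (face_core_nonempty hT F).choose_spec

lemma rep_mem_core (hT : IsLFCTiling T) {w : NF T →₀ ℝ} (hw : ∀ F, 0 ≤ w F) {F : NF T}
    (hF : F ∈ w.support) (htop : ∀ G ∈ w.support, G ≤ F) :
    0 < mass w ∧ (mass w)⁻¹ • Finsupp.linearCombination ℝ (bc hT) w ∈ core F.s := by
  have hwF : 0 < w F := lt_of_le_of_ne (hw F) (Ne.symm (Finsupp.mem_support_iff.1 hF))
  have hm : 0 < mass w := by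
    rw [mass_eq_sum]
    exact Finset.sum_pos' (fun G _ => hw G) ⟨F, hF, hwF⟩
  refine ⟨hm, ?_⟩
  set m := mass w with hmdef
  have hsum : w F + ∑ G ∈ w.support.erase F, w G = m := by
    rw [hmdef, mass_eq_sum, Finset.add_sum_erase _ _ hF]
  have hlc : Finsupp.linearCombination ℝ (bc hT) w
      = w F • bc hT F + ∑ G ∈ w.support.erase F, w G • bc hT G := by
    rw [Finsupp.linearCombination_apply, Finsupp.sum, Finset.add_sum_erase _ (fun G => w G • bc hT G) hF]
  rcases eq_or_ne (∑ G ∈ w.support.erase F, w G) 0 with h0 | h0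
  · have h1 : ∑ G ∈ w.support.erase F, w G • bc hT G = 0 := by
      rw [Finset.sum_eq_zero_iff_of_nonneg (fun G _ => hw G)] at h0
      exact Finset.sum_eq_zero fun G hG => by rw [h0 G hG, zero_smul]
    rw [hlc, h1, add_zero, ← hsum, h0, add_zero, smul_smul, inv_mul_cancel₀ hwF.ne', one_smul]
    exact bc_mem hT F
  · set k := ∑ G ∈ w.support.erase F, w G with hk
    have hkpos : 0 < k := lt_of_le_of_ne (Finset.sum_nonneg fun G _ => hw G) (Ne.symm h0)
    have hz : k⁻¹ • ∑ G ∈ w.support.erase F, w G • bc hT G ∈ F.s := by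
      have := (face_convex hT F).sum_mem (t := w.support.erase F) (w := fun G => k⁻¹ * w G)
        (z := bc hT) (fun G _ => by have := hw G; positivity)
        (by rw [← Finset.mul_sum, ← hk, inv_mul_cancel₀ h0])
        (fun G hG => (htop G (Finset.mem_of_mem_erase hG)) (bc_mem hT G).1)
      simpa only [Finset.smul_sum, smul_smul] using this
    have := core_combo (face_convex hT F) (bc_mem hT F) hz (a := m⁻¹ * w F) (by positivity)
      (by rw [inv_mul_le_iff₀ hm]; linarith)
    convert this using 1
    rw [hlc, smul_add, smul_smul, smul_smul]
    congr 2
    field_simp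
    linarith

lemma uniq_aux (hT : IsLFCTiling T) (n : ℕ) : ∀ (w v : NF T →₀ ℝ),
    w.support.card + v.support.card ≤ n →
    (∀ F, 0 ≤ w F) → (∀ F, 0 ≤ v F) → IsChain (· ≤ ·) (w.support : Set (NF T)) →
    IsChain (· ≤ ·) (v.support : Set (NF T)) → mass w = mass v →
    Finsupp.linearCombination ℝ (bc hT) w = Finsupp.linearCombination ℝ (bc hT) v → w = v := by
  induction n with
  | zero =>
    intro w v hn _ _ _ _ _ _
    have h1 : w.support.card = 0 := by omega
    have h2 : v.support.card = 0 := by omega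
    rw [Finset.card_eq_zero, Finsupp.support_eq_empty] at h1 h2
    rw [h1, h2]
  | succ n ih =>
    -- the case `w F ≤ v F`
    have main : ∀ (w v : NF T →₀ ℝ) (F : NF T),
        w.support.card + v.support.card ≤ n + 1 →
        (∀ F, 0 ≤ w F) → (∀ F, 0 ≤ v F) → IsChain (· ≤ ·) (w.support : Set (NF T)) →
        IsChain (· ≤ ·) (v.support : Set (NF T)) → mass w = mass v →
        Finsupp.linearCombination ℝ (bc hT) w = Finsupp.linearCombination ℝ (bc hT) v →
        F ∈ w.support → F ∈ v.support → w F ≤ v F → w = v := by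
      intro w v F hn hw hv hcw hcv hm hl hFw hFv hle
      have hsw : (w - Finsupp.single F (w F)).support ⊆ w.support.erase F := by
        intro G hG
        rw [Finsupp.mem_support_iff, Finsupp.sub_apply] at hG
        by_cases hGF : G = F
        · subst hGF
          simp at hG
        · rw [Finsupp.single_eq_of_ne hGF, sub_zero] at hG
          exact Finset.mem_erase.2 ⟨hGF, Finsupp.mem_support_iff.2 hG⟩
      have hsv : (v - Finsupp.single F (w F)).support ⊆ v.support := by
        intro G hG
        rw [Finsupp.mem_support_iff, Finsupp.sub_apply] at hG
        by_cases hGF : G = F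
        · subst hGF
          exact hFv
        · rw [Finsupp.single_eq_of_ne hGF, sub_zero] at hG
          exact Finsupp.mem_support_iff.2 hG
      have h := ih (w - Finsupp.single F (w F)) (v - Finsupp.single F (w F)) ?_ ?_ ?_ ?_ ?_ ?_ ?_
      · exact sub_left_injective h
      · have h1 := Finset.card_le_card hsw
        have h2 := Finset.card_le_card hsv
        rw [Finset.card_erase_of_mem hFw] at h1
        have : 0 < w.support.card := Finset.card_pos.2 ⟨F, hFw⟩
        omega
      · intro G
        by_cases hGF : G = F
        · subst hGF
          simp
        · simp [Finsupp.single_eq_of_ne hGF, hw G]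
      · intro G
        by_cases hGF : G = F
        · subst hGF
          simpa using hle
        · simp [Finsupp.single_eq_of_ne hGF, hv G]
      · refine hcw.mono ?_
        exact_mod_cast hsw.trans (Finset.erase_subset _ _)
      · refine hcv.mono ?_
        exact_mod_cast hsv
      · rw [mass_sub, mass_sub, hm]
      · rw [map_sub, map_sub, hl]
    intro w v hn hw hv hcw hcv hm hl
    by_cases hw0 : w.support.Nonempty
    · obtain ⟨F, hF, htop⟩ := exists_top hcw hw0
      obtain ⟨hmw, hcore⟩ := rep_mem_core hT hw hF htop
      have hv0 : v.support.Nonempty := by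
        by_contra hne
        rw [Finset.not_nonempty_iff_eq_empty, Finsupp.support_eq_empty] at hne
        rw [hm, hne] at hmw
        simp [mass] at hmw
      obtain ⟨G, hG, htop'⟩ := exists_top hcv hv0
      obtain ⟨hmv, hcore'⟩ := rep_mem_core hT hv hG htop'
      rw [← hm, ← hl] at hcore'
      obtain rfl := core_unique hT hcore hcore'
      rcases le_total (w F) (v F) with h | h
      · exact main w v F hn hw hv hcw hcv hm hl hF hG h
      · exact (main v w F (by omega) hv hw hcv hcw hm.symm hl.symm hG hF h).symm
    · rw [Finset.not_nonempty_iff_eq_empty, Finsupp.support_eq_empty] at hw0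
      have : mass v = 0 := by rw [← hm, hw0]; simp [mass]
      rw [hw0, eq_zero_of_mass hv this]

lemma rep_unique (hT : IsLFCTiling T) {w v : NF T →₀ ℝ} {x : EucSp e}
    (hw : IsRep (bc hT) w x) (hv : IsRep (bc hT) v x) : w = v :=
  uniq_aux hT _ w v le_rfl hw.nonneg hv.nonneg hw.chain hv.chain
    (by rw [hw.mass_one, hv.mass_one]) (by rw [hw.sum_eq, hv.sum_eq])

lemma rep_exists_aux (hT : IsLFCTiling T) (n : ℕ) : ∀ (F : NF T) (x : EucSp e), rk F ≤ n →
    x ∈ core F.s → ∃ w, IsRep (bc hT) w x ∧ ∀ G ∈ w.support, G ≤ F := by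
  induction n using Nat.strong_induction_on with
  | _ n ih =>
  intro F x hn hx
  by_cases hxb : x = bc hT F
  · refine ⟨Finsupp.single F 1, ⟨?_, ?_, mass_single _ _, by simp [hxb]⟩, ?_⟩
    · intro G
      exact Finsupp.single_nonneg.2 zero_le_one G
    · rw [Finsupp.support_single_ne_zero _ one_ne_zero]
      simp
    · intro G hG
      rw [Finsupp.support_single_ne_zero _ one_ne_zero, Finset.mem_singleton] at hG
      exact hG.le
  set b := bc hT F with hb
  set A : Set ℝ := {τ | b + τ • (x - b) ∈ F.s} with hA
  have hne : 0 < ‖x - b‖ := norm_pos_iff.2 (sub_ne_zero.2 hxb)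
  have hAclosed : IsClosed A :=
    (face_compact hT F).isClosed.preimage (by fun_prop)
  have hAbdd : BddAbove A := by
    obtain ⟨R, hR⟩ := (face_compact hT F).isBounded.exists_norm_le
    refine ⟨(R + ‖b‖) / ‖x - b‖, fun τ hτ => ?_⟩
    rw [le_div_iff₀ hne]
    have h1 := hR _ hτ
    have h2 : ‖τ • (x - b)‖ ≤ ‖b + τ • (x - b)‖ + ‖b‖ := by
      have := norm_sub_le (b + τ • (x - b)) b
      simpa using this
    rw [norm_smul] at h2
    have h3 := mul_le_mul_of_nonneg_right (le_abs_self τ) hne.le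
    rw [Real.norm_eq_abs] at h2
    linarith
  have h1A : (1 : ℝ) ∈ A := by
    show b + (1 : ℝ) • (x - b) ∈ F.s
    simpa using hx.1
  set τ := sSup A with hτ
  have hτA : τ ∈ A := hAclosed.csSup_mem ⟨1, h1A⟩ hAbdd
  have hτ1 : 1 ≤ τ := le_csSup hAbdd h1A
  have hτ0 : 0 < τ := by linarith
  set y := b + τ • (x - b) with hy
  obtain ⟨G, hG⟩ := exists_car hT y
  have hGF : G ≤ F := core_sub hT hG hτA
  have hne' : G ≠ F := by
    rintro rfl
    obtain ⟨ε, hε, h⟩ := hG.2 b (bc_mem hT G).1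
    have : τ + ε * τ ∈ A := by
      show b + (τ + ε * τ) • (x - b) ∈ G.s
      convert h using 1
      rw [hy]
      module
    have := le_csSup hAbdd this
    nlinarith
  have hlt : G < F := lt_of_le_of_ne hGF hne'
  obtain ⟨w, hw, hwG⟩ := ih (rk G) ((rk_strictMono hT hlt).trans_le hn) G y le_rfl hG
  have hi1 : τ⁻¹ ≤ 1 := inv_le_one_of_one_le₀ hτ1
  have hnn : ∀ H, 0 ≤ (Finsupp.single F (1 - τ⁻¹) + τ⁻¹ • w) H := by
    intro H
    have h1 := hw.nonneg H
    have h2 : 0 ≤ (Finsupp.single F (1 - τ⁻¹)) H :=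
      Finsupp.single_nonneg.2 (sub_nonneg.2 hi1) H
    have h3 : 0 ≤ τ⁻¹ := by positivity
    rw [Finsupp.add_apply, Finsupp.smul_apply, smul_eq_mul]
    positivity
  have hsupp : (Finsupp.single F (1 - τ⁻¹) + τ⁻¹ • w).support ⊆ insert F w.support := by
    intro H hH
    rw [Finset.mem_insert]
    by_contra hcon
    push Not at hcon
    rw [Finsupp.mem_support_iff] at hH
    apply hH
    rw [Finsupp.add_apply, Finsupp.smul_apply, Finsupp.single_eq_of_ne hcon.1,
      Finsupp.notMem_support_iff.1 hcon.2]
    simp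
  refine ⟨Finsupp.single F (1 - τ⁻¹) + τ⁻¹ • w, ⟨hnn, ?_, ?_, ?_⟩, ?_⟩
  · have : IsChain (· ≤ ·) (insert F (w.support : Set (NF T))) := by
      refine hw.chain.insert fun H hH _ => Or.inr ((hwG H hH).trans hGF)
    refine this.mono ?_
    exact_mod_cast hsupp
  · rw [mass_add, mass_smul, mass_single, hw.mass_one]
    ring
  · rw [map_add, map_smul, hw.sum_eq, Finsupp.linearCombination_single, hy, ← hb,
      smul_add, smul_smul, inv_mul_cancel₀ hτ0.ne']
    module
  · intro H hH
    rcases Finset.mem_insert.1 (hsupp hH) with h | h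
    · exact h.le
    · exact (hwG H h).trans hGF

end Tiling

end LFC

open scoped Classical
open scoped Topology
set_option linter.unusedSectionVars false

namespace LFC

/-- Data of a (locally finite) triangulation of Euclidean space by the chains of a poset. -/
structure Tri (e : ℕ) (V : Type) [PartialOrder V] where
  epos : 1 ≤ e
  b : V → EucSp e
  rk : V → ℕ
  rk_mono : StrictMono rk
  rk_le : ∀ F, rk F ≤ e
  cnt : Countable V
  ex : ∀ x, ∃ w, IsRep b w x
  uniq : ∀ x w v, IsRep b w x → IsRep b v x → w = v
  lf : ∀ x, ∃ N ∈ 𝓝 x, {F | ∃ y ∈ N, ∃ w, IsRep b w y ∧ F ∈ w.support}.Finite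

section
variable {e : ℕ} {V : Type} [PartialOrder V]

lemma supp_combo {w v : V →₀ ℝ} (hw : ∀ F, 0 ≤ w F) (hv : ∀ F, 0 ≤ v F) {a c : ℝ} (ha : 0 < a)
    (hc : 0 < c) : (a • w + c • v).support = w.support ∪ v.support := by
  ext F
  simp only [Finsupp.mem_support_iff, Finsupp.add_apply, Finsupp.smul_apply, smul_eq_mul,
    Finset.mem_union]
  have h1 := hw F
  have h2 := hv F
  constructor
  · intro h
    by_contra hh
    push Not at hh
    rw [hh.1, hh.2] at h
    simp at h
  · rintro (h | h)
    · have : 0 < w F := lt_of_le_of_ne h1 (Ne.symm h)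
      positivity
    · have : 0 < v F := lt_of_le_of_ne h2 (Ne.symm h)
      positivity

lemma IsRep.combo {b : V → EucSp e} {w v : V →₀ ℝ} {x y : EucSp e} (hw : IsRep b w x)
    (hv : IsRep b v y) (hch : IsChain (· ≤ ·) ((w.support ∪ v.support : Finset V) : Set V))
    {a c : ℝ} (ha : 0 < a) (hc : 0 < c) (hac : a + c = 1) :
    IsRep b (a • w + c • v) (a • x + c • y) where
  nonneg F := by
    have h1 := hw.nonneg F
    have h2 := hv.nonneg F
    simp only [Finsupp.add_apply, Finsupp.smul_apply, smul_eq_mul]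
    positivity
  chain := by rwa [supp_combo hw.nonneg hv.nonneg ha hc]
  mass_one := by rw [mass_add, mass_smul, mass_smul, hw.mass_one, hv.mass_one]; linarith
  sum_eq := by rw [map_add, map_smul, map_smul, hw.sum_eq, hv.sum_eq]

/-- Uniform weights. -/
noncomputable def unif (D : Finset V) : V →₀ ℝ := Finsupp.indicator D fun _ _ => ((D.card : ℝ))⁻¹

lemma unif_apply (D : Finset V) (F : V) : unif D F = if F ∈ D then ((D.card : ℝ))⁻¹ else 0 := by
  simp [unif, Finsupp.indicator_apply]

lemma unif_supp {D : Finset V} (hD : D.Nonempty) : (unif D).support = D := by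
  ext F
  have : (D.card : ℝ) ≠ 0 := by exact_mod_cast hD.card_pos.ne'
  rw [Finsupp.mem_support_iff, unif_apply]
  by_cases h : F ∈ D <;> simp [h]
  exact hD.ne_empty

lemma unif_rep (b : V → EucSp e) {D : Finset V} (hD : D.Nonempty)
    (hch : IsChain (· ≤ ·) (D : Set V)) :
    IsRep b (unif D) (Finsupp.linearCombination ℝ b (unif D)) where
  nonneg F := by rw [unif_apply]; split_ifs <;> positivity
  chain := by rwa [unif_supp hD]
  mass_one := by
    have : (D.card : ℝ) ≠ 0 := by exact_mod_cast hD.card_pos.ne'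
    rw [mass_eq_sum, unif_supp hD, Finset.sum_congr rfl (fun F hF => by rw [unif_apply, if_pos hF])]
    simp [this]
  sum_eq := rfl

lemma single_rep (b : V → EucSp e) (F : V) : IsRep b (Finsupp.single F 1) (b F) where
  nonneg G := by
    by_cases h : G = F
    · subst h; simp
    · simp [Finsupp.single_eq_of_ne h]
  chain := by
    rw [Finsupp.support_single _ one_ne_zero]; simp
  mass_one := mass_single _ _
  sum_eq := by simp

end

namespace Tri

variable {e : ℕ} {V : Type} [PartialOrder V] (X : Tri e V)

/-- barycentric weights -/
noncomputable def wt (x : EucSp e) : V →₀ ℝ := (X.ex x).choose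

lemma wt_rep (x : EucSp e) : IsRep X.b (X.wt x) x := (X.ex x).choose_spec

/-- carrier -/
noncomputable def C (x : EucSp e) : Finset V := (X.wt x).support

lemma C_eq {w : V →₀ ℝ} {x : EucSp e} (h : IsRep X.b w x) : X.C x = w.support := by
  rw [C, X.uniq x _ _ (X.wt_rep x) h]

lemma C_chain (x : EucSp e) : IsChain (· ≤ ·) (X.C x : Set V) := (X.wt_rep x).chain

lemma C_nonempty (x : EucSp e) : (X.C x).Nonempty := by
  by_contra h
  rw [Finset.not_nonempty_iff_eq_empty, C, Finsupp.support_eq_empty] at h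
  have := (X.wt_rep x).mass_one
  rw [h] at this
  simp [mass] at this

lemma C_b (F : V) : X.C (X.b F) = {F} := by
  rw [X.C_eq (single_rep X.b F), Finsupp.support_single _ one_ne_zero]

/-- The barycenter. -/
noncomputable def bary (D : Finset V) : EucSp e := Finsupp.linearCombination ℝ X.b (unif D)

lemma C_bary {D : Finset V} (hD : D.Nonempty) (hch : IsChain (· ≤ ·) (D : Set V)) :
    X.C (X.bary D) = D := by
  rw [bary, X.C_eq (unif_rep X.b hD hch), unif_supp hD]

lemma C_combo {x y : EucSp e} (hch : IsChain (· ≤ ·) ((X.C x ∪ X.C y : Finset V) : Set V))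
    {a c : ℝ} (ha : 0 < a) (hc : 0 < c) (hac : a + c = 1) :
    X.C (a • x + c • y) = X.C x ∪ X.C y := by
  rw [X.C_eq ((X.wt_rep x).combo (X.wt_rep y) hch ha hc hac),
    supp_combo (X.wt_rep x).nonneg (X.wt_rep y).nonneg ha hc]
  rfl

lemma convex_cell {D : Finset V} (hch : IsChain (· ≤ ·) (D : Set V)) :
    Convex ℝ {y | X.C y ⊆ D} := by
  rw [convex_iff_forall_pos]
  intro x hx y hy a c ha hc hac
  have hu : X.C x ∪ X.C y ⊆ D := Finset.union_subset hx hy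
  show X.C _ ⊆ D
  rw [X.C_combo (hch.mono (by exact_mod_cast hu)) ha hc hac]
  exact hu

lemma mem_hull {x : EucSp e} {D : Finset V} (hx : X.C x ⊆ D) :
    x ∈ convexHull ℝ (X.b '' D) := by
  have h := X.wt_rep x
  have h1 := h.sum_eq
  have h2 := h.mass_one
  rw [mass_eq_sum] at h2
  rw [Finsupp.linearCombination_apply, Finsupp.sum] at h1
  have : ∑ i ∈ (X.wt x).support, (X.wt x) i • X.b i ∈ convexHull ℝ (X.b '' D) :=
    (convex_convexHull ℝ _).sum_mem (fun i _ => h.nonneg i) h2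
      (fun i hi => subset_convexHull ℝ _ ⟨i, hx hi, rfl⟩)
  rwa [h1] at this

lemma cell_eq {D : Finset V} (hch : IsChain (· ≤ ·) (D : Set V)) :
    {y | X.C y ⊆ D} = convexHull ℝ (X.b '' D) := by
  apply Set.Subset.antisymm
  · intro y hy
    exact X.mem_hull hy
  · apply convexHull_min _ (X.convex_cell hch)
    rintro _ ⟨F, hF, rfl⟩
    show X.C _ ⊆ D
    rw [X.C_b]
    simpa using hF

lemma closed_cell {D : Finset V} (hch : IsChain (· ≤ ·) (D : Set V)) :
    IsClosed {y | X.C y ⊆ D} := by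
  rw [X.cell_eq hch]
  exact ((D.finite_toSet.image _).isCompact_convexHull ℝ).isClosed

lemma semicont (x : EucSp e) : ∀ᶠ y in 𝓝 x, X.C x ⊆ X.C y := by
  obtain ⟨N, hN, hfin⟩ := X.lf x
  set A := hfin.toFinset with hA
  have h1 : ∀ᶠ y in 𝓝 x, ∀ D ∈ A.powerset, IsChain (· ≤ ·) (D : Set V) → ¬ X.C x ⊆ D → ¬ X.C y ⊆ D := by
    rw [Filter.eventually_all_finset]
    intro D _
    by_cases hch : IsChain (· ≤ ·) (D : Set V)
    · by_cases hx : X.C x ⊆ D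
      · exact Filter.Eventually.of_forall fun y _ h => absurd hx h
      · filter_upwards [(X.closed_cell hch).isOpen_compl.mem_nhds hx] with y hy _ _
        exact hy
    · exact Filter.Eventually.of_forall fun y h => absurd h hch
  filter_upwards [h1, hN] with y hy hyN
  by_contra hc
  refine hy (X.C y) ?_ (X.C_chain y) hc le_rfl
  rw [Finset.mem_powerset]
  intro F hF
  rw [hA, Set.Finite.mem_toFinset]
  exact ⟨y, hyN, _, X.wt_rep y, hF⟩

lemma near {q : EucSp e} {D : Finset V} (hch : IsChain (· ≤ ·) (D : Set V)) (hq : X.C q ⊆ D)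
    {N : Set (EucSp e)} (hN : N ∈ 𝓝 q) : ∃ y ∈ N, X.C y = D := by
  have hD : D.Nonempty := (X.C_nonempty q).mono hq
  have hc : ContinuousAt (fun ε : ℝ => (1 - ε) • q + ε • X.bary D) 0 := by fun_prop
  have h0 : (fun ε : ℝ => (1 - ε) • q + ε • X.bary D) 0 = q := by simp
  have h1 : ∀ᶠ ε in 𝓝[>] (0:ℝ), (1 - ε) • q + ε • X.bary D ∈ N := by
    apply nhdsWithin_le_nhds
    apply hc
    rw [h0]
    exact hN
  have h2 : ∀ᶠ ε in 𝓝[>] (0:ℝ), ε < 1 := nhdsWithin_le_nhds (Iio_mem_nhds one_pos)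
  obtain ⟨ε, ⟨hε, hε1⟩, hε0⟩ := ((h1.and h2).and self_mem_nhdsWithin).exists
  refine ⟨_, hε, ?_⟩
  have hu : X.C q ∪ X.C (X.bary D) = D := by rw [X.C_bary hD hch, Finset.union_eq_right.2 hq]
  rw [X.C_combo (by rw [hu]; exact hch) (by linarith) hε0 (by ring), hu]

end Tri
end LFC

open scoped Classical
open scoped Topology
set_option linter.unusedSectionVars false

namespace LFC

/-- Flags, as strictly monotone enumerations. -/
def Fl (e : ℕ) (V : Type) [PartialOrder V] : Type := {Φ : Fin (e+1) → V // StrictMono Φ}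

namespace Fl
variable {e : ℕ} {V : Type} [PartialOrder V]

instance : CoeFun (Fl e V) (fun _ => Fin (e+1) → V) := ⟨Subtype.val⟩

/-- constructor -/
def mk (f : Fin (e+1) → V) (hf : StrictMono f) : Fl e V := ⟨f, hf⟩

lemma mk_apply (f : Fin (e+1) → V) (hf : StrictMono f) (i : Fin (e+1)) : (mk f hf) i = f i := rfl

lemma ext' {Φ Ψ : Fl e V} (h : ∀ i, Φ i = Ψ i) : Φ = Ψ := Subtype.ext (funext h)

/-- set of faces -/
noncomputable def fs (Φ : Fl e V) : Finset V := Finset.univ.image Φ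

lemma mem_fs {Φ : Fl e V} {F : V} : F ∈ Φ.fs ↔ ∃ i, Φ i = F := by simp [fs]

lemma fs_chain (Φ : Fl e V) : IsChain (· ≤ ·) (Φ.fs : Set V) := by
  have : (Φ.fs : Set V) = Set.range Φ := by simp [fs]
  rw [this]
  exact Φ.2.monotone.isChain_range

lemma fs_card (Φ : Fl e V) : Φ.fs.card = e + 1 := by
  rw [fs, Finset.card_image_of_injective _ Φ.2.injective]; simp

lemma fs_inj {Φ Ψ : Fl e V} (h : Φ.fs = Ψ.fs) : Φ = Ψ := by
  apply Subtype.ext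
  rw [← StrictMono.range_inj Φ.2 Ψ.2]
  have : ((Φ.fs : Finset V) : Set V) = Ψ.fs := by rw [h]
  simpa [fs] using this

end Fl

namespace Tri

variable {e : ℕ} {V : Type} [PartialOrder V] (X : Tri e V)

lemma rk_flag (Φ : Fl e V) (i : Fin (e+1)) : X.rk (Φ i) = i := by
  let f : Fin (e+1) → Fin (e+1) := fun i => ⟨X.rk (Φ i), Nat.lt_succ_of_le (X.rk_le _)⟩
  have hf : StrictMono f := fun i j hij => X.rk_mono (Φ.2 hij)
  have : f = id := by
    rw [← StrictMono.range_inj hf strictMono_id]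
    rw [Set.range_id, Set.range_eq_univ]
    exact Finite.injective_iff_surjective.1 hf.injective
  exact congrArg Fin.val (congrFun this i)

lemma rk_injOn {D : Set V} (hch : IsChain (· ≤ ·) D) : Set.InjOn X.rk D := by
  intro F hF G hG h
  by_contra hne
  rcases hch.total hF hG with h1 | h1
  · exact absurd h (X.rk_mono (lt_of_le_of_ne h1 hne)).ne
  · exact absurd h (X.rk_mono (lt_of_le_of_ne h1 (Ne.symm hne))).ne'

lemma card_le (X : Tri e V) {D : Finset V} (hch : IsChain (· ≤ ·) (D : Set V)) : D.card ≤ e + 1 := by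
  have := Finset.card_le_card_of_injOn (t := Finset.range (e+1)) X.rk
    (fun F _ => by simpa using Nat.lt_succ_of_le (X.rk_le F)) (X.rk_injOn hch)
  simpa using this

lemma fs_eq_of_subset (X : Tri e V) {Φ : Fl e V} {D : Finset V} (hch : IsChain (· ≤ ·) (D : Set V))
    (h : Φ.fs ⊆ D) : D = Φ.fs :=
  (Finset.eq_of_subset_of_card_le h (by rw [Φ.fs_card]; exact X.card_le hch)).symm

lemma exists_max (X : Tri e V) {D : Finset V} (hch : IsChain (· ≤ ·) (D : Set V)) :
    ∃ M : Finset V, D ⊆ M ∧ IsChain (· ≤ ·) (M : Set V) ∧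
      ∀ M' : Finset V, IsChain (· ≤ ·) (M' : Set V) → M ⊆ M' → M' = M := by
  obtain ⟨M, ⟨h1, h2⟩, h3⟩ := WellFounded.has_min (measure (fun M : Finset V => e + 1 - M.card)).wf
    {M | D ⊆ M ∧ IsChain (· ≤ ·) (M : Set V)} ⟨D, subset_rfl, hch⟩
  refine ⟨M, h1, h2, fun M' hM' hs => ?_⟩
  have h4 := h3 M' ⟨h1.trans hs, hM'⟩
  have h5 := X.card_le hM'
  have h4' : ¬ (e + 1 - M'.card < e + 1 - M.card) := h4
  refine (Finset.eq_of_subset_of_card_le hs ?_).symm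
  omega

lemma hull_nhds {M : Finset V} (hne : M.Nonempty) (hM : IsChain (· ≤ ·) (M : Set V))
    (hmax : ∀ M' : Finset V, IsChain (· ≤ ·) (M' : Set V) → M ⊆ M' → M' = M) :
    affineSpan ℝ (X.b '' M) = ⊤ := by
  rw [← interior_convexHull_nonempty_iff_affineSpan_eq_top]
  refine ⟨X.bary M, mem_interior_iff_mem_nhds.2 ?_⟩
  filter_upwards [X.semicont (X.bary M)] with y hy
  rw [X.C_bary hne hM] at hy
  exact X.mem_hull (hmax _ (X.C_chain y) hy).le

lemma exists_flag (X : Tri e V) {D : Finset V} (hch : IsChain (· ≤ ·) (D : Set V)) :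
    ∃ Φ : Fl e V, D ⊆ Φ.fs := by
  -- reduce to nonempty chains
  wlog hD : D.Nonempty generalizing D
  · obtain ⟨Φ, _⟩ := this (X.C_chain 0) (X.C_nonempty 0)
    rw [Finset.not_nonempty_iff_eq_empty] at hD
    exact ⟨Φ, by simp [hD]⟩
  obtain ⟨M, hDM, hM, hmax⟩ := X.exists_max hch
  have hne := hD.mono hDM
  have hspan := X.hull_nhds hne hM hmax
  have hcard : e + 1 ≤ M.card := by
    have h1 := finrank_vectorSpan_image_finset_le ℝ X.b M (n := M.card - 1)
      (by have := hne.card_pos; omega)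
    rw [Finset.coe_image, ← direction_affineSpan, hspan, AffineSubspace.direction_top, finrank_top] at h1
    simp at h1
    have := hne.card_pos
    omega
  have himg : M.image X.rk = Finset.range (e+1) := by
    apply Finset.eq_of_subset_of_card_le
    · intro n hn
      obtain ⟨F, _, rfl⟩ := Finset.mem_image.1 hn
      simpa using Nat.lt_succ_of_le (X.rk_le F)
    · rw [Finset.card_image_of_injOn (X.rk_injOn hM)]
      simpa using hcard
  have hex : ∀ k : Fin (e+1), ∃ F ∈ M, X.rk F = k := by
    intro k
    have : (k : ℕ) ∈ M.image X.rk := by rw [himg, Finset.mem_range]; exact k.2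
    simpa using this
  choose f hfM hfk using hex
  have hf : StrictMono f := by
    intro i j hij
    have hne : f i ≠ f j := fun h => by
      have := hfk i
      rw [h, hfk j] at this
      exact hij.ne' (Fin.ext this)
    rcases hM.total (hfM i) (hfM j) with h | h
    · exact lt_of_le_of_ne h hne
    · have := X.rk_mono (lt_of_le_of_ne h hne.symm)
      rw [hfk, hfk] at this
      exact absurd hij (not_lt.2 (le_of_lt this))
  refine ⟨Fl.mk f hf, hDM.trans (Eq.subset ?_)⟩
  symm
  apply Finset.eq_of_subset_of_card_le
  · intro F hF
    obtain ⟨i, rfl⟩ := Fl.mem_fs.1 hF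
    exact hfM i
  · rw [Fl.fs_card]
    exact X.card_le hM

/-- Flags whose chamber contains `x`. -/
def St (x : EucSp e) : Set (Fl e V) := {Φ | X.C x ⊆ Φ.fs}

/-- Missing ranks. -/
noncomputable def J (x : EucSp e) : Finset (Fin (e+1)) :=
  Finset.univ.filter fun k => ∀ F ∈ X.C x, X.rk F ≠ k

lemma mem_J {x : EucSp e} {k : Fin (e+1)} : k ∈ X.J x ↔ ∀ F ∈ X.C x, X.rk F ≠ k := by simp [J]

lemma St_nonempty (x : EucSp e) : (X.St x).Nonempty := X.exists_flag (X.C_chain x)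

lemma mem_C_iff {x : EucSp e} {Φ : Fl e V} (h : Φ ∈ X.St x) {k : Fin (e+1)} :
    Φ k ∈ X.C x ↔ k ∉ X.J x := by
  rw [mem_J]
  push Not
  constructor
  · intro hk
    exact ⟨_, hk, X.rk_flag Φ k⟩
  · rintro ⟨F, hF, hk⟩
    obtain ⟨i, rfl⟩ := Fl.mem_fs.1 (h hF)
    rw [X.rk_flag] at hk
    rwa [← Fin.ext hk]

lemma C_image {x : EucSp e} {Φ : Fl e V} (h : Φ ∈ X.St x) : X.C x = (X.J x)ᶜ.image Φ := by
  ext F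
  simp only [Finset.mem_image, Finset.mem_compl]
  constructor
  · intro hF
    obtain ⟨i, rfl⟩ := Fl.mem_fs.1 (h hF)
    exact ⟨i, (X.mem_C_iff h).1 hF, rfl⟩
  · rintro ⟨i, hi, rfl⟩
    exact (X.mem_C_iff h).2 hi

lemma card_J (x : EucSp e) : (X.C x).card + (X.J x).card = e + 1 := by
  obtain ⟨Φ, h⟩ := X.St_nonempty x
  rw [X.C_image h, Finset.card_image_of_injective _ Φ.2.injective, Finset.card_compl]
  have := Finset.card_le_univ (X.J x)
  simp at this ⊢
  omega

lemma St_agree {x : EucSp e} {Φ Ψ : Fl e V} (h : Φ ∈ X.St x) (h' : Ψ ∈ X.St x) {k : Fin (e+1)}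
    (hk : k ∉ X.J x) : Φ k = Ψ k := by
  have h1 := (X.mem_C_iff h).2 hk
  obtain ⟨i, hi⟩ := Fl.mem_fs.1 (h' h1)
  have : X.rk (Ψ i) = X.rk (Φ k) := by rw [hi]
  rw [X.rk_flag, X.rk_flag] at this
  rw [← hi, Fin.ext this]

lemma St_of_agree {x : EucSp e} {Φ Ψ : Fl e V} (h : Φ ∈ X.St x)
    (hk : ∀ k, k ∉ X.J x → Ψ k = Φ k) : Ψ ∈ X.St x := by
  show X.C x ⊆ Ψ.fs
  rw [X.C_image h]
  intro F hF
  simp only [Finset.mem_image, Finset.mem_compl] at hF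
  obtain ⟨i, hi, rfl⟩ := hF
  rw [← hk i hi]
  exact Fl.mem_fs.2 ⟨i, rfl⟩

lemma St_anti {x y : EucSp e} (h : X.C x ⊆ X.C y) : X.St y ⊆ X.St x := fun _ hΦ => h.trans hΦ

lemma J_anti {x y : EucSp e} (h : X.C x ⊆ X.C y) : X.J y ⊆ X.J x := by
  intro k hk
  rw [mem_J] at hk ⊢
  exact fun F hF => hk F (h hF)

lemma St_of_eq {x : EucSp e} {Φ : Fl e V} (h : X.C x = Φ.fs) : X.St x = {Φ} := by
  ext Ψ
  constructor
  · intro hΨ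
    have : Φ.fs ⊆ Ψ.fs := h ▸ hΨ
    exact Fl.fs_inj (X.fs_eq_of_subset Ψ.fs_chain this)
  · rintro rfl
    exact h.le

lemma J_of_eq {x : EucSp e} {Φ : Fl e V} (h : X.C x = Φ.fs) : X.J x = ∅ := by
  have := X.card_J x
  rw [h, Fl.fs_card] at this
  rw [← Finset.card_eq_zero]
  omega

/-- interior of chamber -/
def O (Φ : Fl e V) : Set (EucSp e) := {x | X.C x = Φ.fs}

lemma isOpen_O (Φ : Fl e V) : IsOpen (X.O Φ) := by
  rw [isOpen_iff_mem_nhds]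
  intro x hx
  filter_upwards [X.semicont x] with y hy
  have hx' : X.C x = Φ.fs := hx
  rw [hx'] at hy
  exact X.fs_eq_of_subset (X.C_chain y) hy

lemma near_O {q : EucSp e} {Φ : Fl e V} (h : Φ ∈ X.St q) {N : Set (EucSp e)} (hN : N ∈ 𝓝 q) :
    (N ∩ X.O Φ).Nonempty := by
  obtain ⟨y, hy, hC⟩ := X.near Φ.fs_chain h hN
  exact ⟨y, hy, hC⟩

lemma O_nonempty (Φ : Fl e V) : (X.O Φ).Nonempty :=
  ⟨_, X.C_bary (Finset.card_pos.1 (by rw [Φ.fs_card]; omega)) Φ.fs_chain⟩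

lemma convex_O (Φ : Fl e V) : Convex ℝ (X.O Φ) := by
  rw [convex_iff_forall_pos]
  intro x hx y hy a c ha hc hac
  have hx' : X.C x = Φ.fs := hx
  have hy' : X.C y = Φ.fs := hy
  show X.C _ = _
  rw [X.C_combo (by rw [hx', hy', Finset.union_self]; exact Φ.fs_chain) ha hc hac, hx', hy',
    Finset.union_self]

end Tri
end LFC

open scoped Classical
open scoped Topology
set_option linter.unusedSectionVars false

namespace LFC
namespace Tri

variable {e : ℕ} {V : Type} [PartialOrder V] (X : Tri e V)

lemma range_fs (Φ : Fl e V) : Set.range (fun i => X.b (Φ i)) = X.b '' Φ.fs := by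
  ext y
  constructor
  · rintro ⟨i, rfl⟩
    exact ⟨Φ i, Fl.mem_fs.2 ⟨i, rfl⟩, rfl⟩
  · rintro ⟨F, hF, rfl⟩
    obtain ⟨i, rfl⟩ := Fl.mem_fs.1 hF
    exact ⟨i, rfl⟩

lemma fs_nonempty (Φ : Fl e V) : Φ.fs.Nonempty := Finset.card_pos.1 (by rw [Φ.fs_card]; omega)

lemma span_flag (Φ : Fl e V) : affineSpan ℝ (Set.range (fun i => X.b (Φ i))) = ⊤ := by
  rw [range_fs]
  exact X.hull_nhds (fs_nonempty Φ) Φ.fs_chain (fun M' hMM h => X.fs_eq_of_subset hMM h)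

/-- The vertices of a chamber form an affine basis. -/
noncomputable def basis (Φ : Fl e V) : AffineBasis (Fin (e+1)) ℝ (EucSp e) :=
  ⟨fun i => X.b (Φ i), by
    rw [affineIndependent_iff_le_finrank_vectorSpan ℝ _ (n := e) (by simp),
      ← direction_affineSpan, X.span_flag, AffineSubspace.direction_top, finrank_top]
    simp, X.span_flag Φ⟩

lemma basis_apply (Φ : Fl e V) (i : Fin (e+1)) : X.basis Φ i = X.b (Φ i) := rfl

lemma coord_eq {Φ : Fl e V} {x : EucSp e} (h : Φ ∈ X.St x) (i : Fin (e+1)) :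
    (X.basis Φ).coord i x = X.wt x (Φ i) := by
  have hs : ∑ i : Fin (e+1), X.wt x (Φ i) = 1 := by
    rw [← (X.wt_rep x).mass_one, mass_eq_sum]
    rw [Finset.sum_subset (s₁ := (X.wt x).support) h (fun F _ hF => by simpa using hF)]
    rw [Fl.fs, Finset.sum_image (fun i _ j _ hij => Φ.2.injective hij)]
  have hx : x = ∑ i : Fin (e+1), X.wt x (Φ i) • X.b (Φ i) := by
    conv_lhs => rw [← (X.wt_rep x).sum_eq]
    rw [Finsupp.linearCombination_apply, Finsupp.sum,
      Finset.sum_subset (s₁ := (X.wt x).support) h (fun F _ hF => by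
        have : X.wt x F = 0 := by simpa using hF
        rw [this, zero_smul])]
    rw [Fl.fs, Finset.sum_image (fun i _ j _ hij => Φ.2.injective hij)]
  have := (X.basis Φ).coord_apply_combination_of_mem (Finset.mem_univ i) (w := fun i => X.wt x (Φ i)) hs
  rw [Finset.affineCombination_eq_linear_combination _ _ _ hs] at this
  rw [← this]
  congr 1

/-- A wall of a chamber. -/
noncomputable def W (Φ : Fl e V) (k : Fin (e+1)) : Finset V := Φ.fs.erase (Φ k)

lemma mem_W {Φ : Fl e V} {k : Fin (e+1)} {F : V} : F ∈ W Φ k ↔ ∃ i, i ≠ k ∧ Φ i = F := by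
  rw [W, Finset.mem_erase, Fl.mem_fs]
  constructor
  · rintro ⟨h, i, rfl⟩
    exact ⟨i, fun h' => h (by rw [h']), rfl⟩
  · rintro ⟨i, hi, rfl⟩
    exact ⟨fun h => hi (Φ.2.injective h), i, rfl⟩

/-- Barycenter of a wall -/
noncomputable def q (Φ : Fl e V) (k : Fin (e+1)) : EucSp e := X.bary (W Φ k)

lemma C_q (Φ : Fl e V) (k : Fin (e+1)) : X.C (X.q Φ k) = W Φ k := by
  apply X.C_bary
  · rw [← Finset.card_pos, W, Finset.card_erase_of_mem (Fl.mem_fs.2 ⟨k, rfl⟩), Φ.fs_card]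
    have := X.epos
    omega
  · exact Φ.fs_chain.mono (by exact_mod_cast Finset.erase_subset _ _)

lemma mem_St_q (Φ : Fl e V) (k : Fin (e+1)) : Φ ∈ X.St (X.q Φ k) := by
  show X.C _ ⊆ _
  rw [C_q]
  exact Finset.erase_subset _ _

lemma J_q (Φ : Fl e V) (k : Fin (e+1)) : X.J (X.q Φ k) = {k} := by
  ext i
  rw [Finset.mem_singleton]
  have := X.mem_C_iff (X.mem_St_q Φ k) (k := i)
  rw [C_q, mem_W] at this
  constructor
  · intro hi
    by_contra hik
    exact (this.1 ⟨i, hik, rfl⟩) hi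
  · rintro rfl
    by_contra hi
    obtain ⟨j, hj, h⟩ := this.2 hi
    exact hj (Φ.2.injective h)

lemma neg_coord {Φ Ψ : Fl e V} {k : Fin (e+1)} (hne : Ψ ≠ Φ) (hag : ∀ i, i ≠ k → Ψ i = Φ i) :
    (X.basis Φ).coord k (X.b (Ψ k)) < 0 := by
  by_contra hge
  push Not at hge
  have hkk : Ψ k ∉ Φ.fs := by
    intro h
    obtain ⟨j, hj⟩ := Fl.mem_fs.1 h
    have : X.rk (Φ j) = X.rk (Ψ k) := by rw [hj]
    rw [X.rk_flag, X.rk_flag] at this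
    have hjk := Fin.ext this
    subst hjk
    exact hne (Fl.ext' fun i => by
      by_cases h : i = j
      · rw [h, hj]
      · exact hag i h)
  have hc : ∀ i, (X.basis Φ).coord i (X.q Φ k) = X.wt (X.q Φ k) (Φ i) := X.coord_eq (X.mem_St_q Φ k)
  have h1 : ∀ᶠ ε in 𝓝[>] (0:ℝ), ∀ i, 0 ≤ (X.basis Φ).coord i (AffineMap.lineMap (X.q Φ k) (X.b (Ψ k)) ε) := by
    rw [Filter.eventually_all]
    intro i
    by_cases hik : i = k
    · subst hik
      filter_upwards [self_mem_nhdsWithin] with ε hε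
      have hε : 0 < ε := hε
      rw [AffineMap.apply_lineMap, hc, AffineMap.lineMap_apply_module]
      have : X.wt (X.q Φ i) (Φ i) = 0 := by
        by_contra h
        have h' : Φ i ∈ X.C (X.q Φ i) := Finsupp.mem_support_iff.2 h
        rw [X.mem_C_iff (X.mem_St_q Φ i), J_q] at h'
        simp at h'
      rw [this, smul_zero, zero_add, smul_eq_mul]
      positivity
    · apply nhdsWithin_le_nhds
      have hpos : 0 < X.wt (X.q Φ k) (Φ i) := by
        apply lt_of_le_of_ne ((X.wt_rep _).nonneg _)
        have h' : Φ i ∈ X.C (X.q Φ k) := by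
          rw [X.mem_C_iff (X.mem_St_q Φ k), J_q]
          simpa using hik
        exact (Finsupp.mem_support_iff.1 h').symm
      have hcont : ContinuousAt (fun ε : ℝ => (X.basis Φ).coord i (AffineMap.lineMap (X.q Φ k) (X.b (Ψ k)) ε)) 0 := by
        have : (fun ε : ℝ => (X.basis Φ).coord i (AffineMap.lineMap (X.q Φ k) (X.b (Ψ k)) ε)) =
          fun ε : ℝ => (1 - ε) * (X.basis Φ).coord i (X.q Φ k) + ε * (X.basis Φ).coord i (X.b (Ψ k)) := by
          funext ε
          rw [AffineMap.apply_lineMap, AffineMap.lineMap_apply_module]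
          rfl
        rw [this]
        fun_prop
      have := hcont.eventually (lt_mem_nhds (a := 0) (by simpa [hc] using hpos))
      filter_upwards [this] with ε hε
      exact hε.le
  have h2 : ∀ᶠ ε in 𝓝[>] (0:ℝ), ε < 1 := nhdsWithin_le_nhds (Iio_mem_nhds one_pos)
  obtain ⟨ε, ⟨hε, hε1⟩, hε0⟩ := ((h1.and h2).and self_mem_nhdsWithin).exists
  have hε0 : 0 < ε := hε0
  have hmem : AffineMap.lineMap (X.q Φ k) (X.b (Ψ k)) ε ∈ convexHull ℝ (Set.range (X.basis Φ)) := by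
    rw [AffineBasis.convexHull_eq_nonneg_coord]
    exact hε
  have hr : Set.range (X.basis Φ) = X.b '' Φ.fs := X.range_fs Φ
  rw [hr, ← X.cell_eq Φ.fs_chain] at hmem
  have hmem' : X.C (AffineMap.lineMap (X.q Φ k) (X.b (Ψ k)) ε) ⊆ Φ.fs := hmem
  rw [AffineMap.lineMap_apply_module, X.C_combo _ (by linarith) hε0 (by ring), X.C_b] at hmem'
  · exact hkk (hmem' (by simp))
  · refine Ψ.fs_chain.mono ?_
    rw [C_q, X.C_b]
    intro F hF
    simp only [Finset.coe_union, Set.mem_union, Finset.mem_coe, Finset.mem_singleton] at hF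
    rcases hF with hF | rfl
    · obtain ⟨i, hi, rfl⟩ := mem_W.1 hF
      rw [← hag i hi]
      exact Fl.mem_fs.2 ⟨i, rfl⟩
    · exact Fl.mem_fs.2 ⟨k, rfl⟩

lemma diamond_uniq (X : Tri e V) {Φ Ψ Ω : Fl e V} {k : Fin (e+1)} (hΨ : Ψ ≠ Φ) (hag : ∀ i, i ≠ k → Ψ i = Φ i)
    (hΩ : Ω ≠ Φ) (hag' : ∀ i, i ≠ k → Ω i = Φ i) : Ψ = Ω := by
  by_contra hne
  have h1 := X.neg_coord hΨ hag
  have h2 := X.neg_coord hΩ hag'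
  have h3 := X.neg_coord (Φ := Ω) (Ψ := Ψ) hne (k := k) (fun i hi => by rw [hag i hi, hag' i hi])
  have hz : ∀ i, i ≠ k → (X.basis Φ).coord k (X.b (Ω i)) = 0 := by
    intro i hi
    rw [hag' i hi]
    exact (X.basis Φ).coord_apply_ne (i := k) (j := i) hi.symm
  have hs := (X.basis Ω).sum_coord_apply_eq_one (X.b (Ψ k))
  have h4 := congrArg ((X.basis Φ).coord k) ((X.basis Ω).affineCombination_coord_eq_self (X.b (Ψ k)))
  rw [Finset.map_affineCombination _ _ _ hs, Finset.affineCombination_eq_linear_combination _ _ _ hs,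
    Finset.sum_eq_single k] at h4
  · rw [← h4] at h1
    have : 0 < (X.basis Ω).coord k (X.b (Ψ k)) • (X.basis Φ).coord k (X.b (Ω k)) := mul_pos_of_neg_of_neg h3 h2
    exact absurd h1 (not_lt.2 this.le)
  · intro i _ hi
    have := hz i hi
    simp only [Function.comp, basis_apply, smul_eq_mul]
    rw [this, mul_zero]
  · simp

lemma diamond_ex (X : Tri e V) (Φ : Fl e V) (k : Fin (e+1)) : ∃ Ψ : Fl e V, Ψ ≠ Φ ∧ ∀ i, i ≠ k → Ψ i = Φ i := by
  by_contra hno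
  push Not at hno
  set q := X.q Φ k with hq
  -- every flag at `q` is `Φ`
  have hone : ∀ Ψ ∈ X.St q, Ψ = Φ := by
    intro Ψ hΨ
    by_contra hne
    obtain ⟨i, hi, h⟩ := hno Ψ hne
    exact h (X.St_agree hΨ (X.mem_St_q Φ k) (by rw [hq, J_q]; simpa using hi))
  have hcell : ∀ᶠ y in 𝓝 q, X.C y ⊆ Φ.fs := by
    filter_upwards [X.semicont q] with y hy
    obtain ⟨Ψ, hΨ⟩ := X.St_nonempty y
    have := hone Ψ (X.St_anti hy hΨ)
    rw [← this]
    exact hΨ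
  have hc : ContinuousAt (fun ε : ℝ => AffineMap.lineMap q (X.b (Φ k)) (-ε)) 0 := by
    simp only [AffineMap.lineMap_apply_module]
    fun_prop
  have h1 := hc.eventually (p := fun y => X.C y ⊆ Φ.fs) (by simpa using hcell)
  have h1' : ∀ᶠ ε in 𝓝[>] (0:ℝ), X.C (AffineMap.lineMap q (X.b (Φ k)) (-ε)) ⊆ Φ.fs := nhdsWithin_le_nhds h1
  obtain ⟨ε, hε, hε0⟩ := (h1'.and self_mem_nhdsWithin).exists
  have hε0 : 0 < ε := hε0
  have hk : X.C (X.b (Φ k)) ⊆ Φ.fs := by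
    rw [X.C_b]; simpa using Fl.mem_fs.2 ⟨k, rfl⟩
  have hcomb := X.C_combo (x := AffineMap.lineMap q (X.b (Φ k)) (-ε)) (y := X.b (Φ k))
    (Φ.fs_chain.mono (by exact_mod_cast Finset.union_subset hε hk)) (a := 1/(1+ε)) (c := ε/(1+ε))
    (by positivity) (by positivity) (by field_simp)
  have heq : (1/(1+ε)) • (AffineMap.lineMap q (X.b (Φ k)) (-ε)) + (ε/(1+ε)) • X.b (Φ k) = q := by
    rw [AffineMap.lineMap_apply_module]
    have : (1 + ε) ≠ 0 := by positivity
    match_scalars <;> field_simp <;> ring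
  rw [heq] at hcomb
  have hin : Φ k ∈ X.C q := by
    rw [hcomb, X.C_b]; simp
  rw [X.mem_C_iff (X.mem_St_q Φ k), J_q] at hin
  simp at hin

/-- The `k`-adjacent flag. -/
noncomputable def adj (k : Fin (e+1)) (Φ : Fl e V) : Fl e V := (X.diamond_ex Φ k).choose

lemma adj_ne (k : Fin (e+1)) (Φ : Fl e V) : X.adj k Φ ≠ Φ := (X.diamond_ex Φ k).choose_spec.1

lemma adj_apply {k : Fin (e+1)} (Φ : Fl e V) {i : Fin (e+1)} (hi : i ≠ k) : X.adj k Φ i = Φ i :=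
  (X.diamond_ex Φ k).choose_spec.2 i hi

lemma eq_adj {k : Fin (e+1)} {Φ Ψ : Fl e V} (hne : Ψ ≠ Φ) (h : ∀ i, i ≠ k → Ψ i = Φ i) :
    Ψ = X.adj k Φ := X.diamond_uniq hne h (X.adj_ne k Φ) (fun _ hi => X.adj_apply Φ hi)

lemma adj_adj (k : Fin (e+1)) (Φ : Fl e V) : X.adj k (X.adj k Φ) = Φ :=
  (X.eq_adj (X.adj_ne k Φ).symm (fun i hi => (X.adj_apply Φ hi).symm)).symm

lemma adj_ne_at (k : Fin (e+1)) (Φ : Fl e V) : X.adj k Φ k ≠ Φ k := fun h =>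
  X.adj_ne k Φ (Fl.ext' fun i => by
    by_cases hi : i = k
    · rw [hi, h]
    · exact X.adj_apply Φ hi)

/-- The `k`-adjacency permutation. -/
noncomputable def r (k : Fin (e+1)) : Equiv.Perm (Fl e V) :=
  Function.Involutive.toPerm (X.adj k) (X.adj_adj k)

lemma r_apply (k : Fin (e+1)) (Φ : Fl e V) : X.r k Φ = X.adj k Φ := rfl

lemma r_mul_self (k : Fin (e+1)) : X.r k * X.r k = 1 := Equiv.ext fun Φ => X.adj_adj k Φ

lemma r_inv (k : Fin (e+1)) : (X.r k)⁻¹ = X.r k := inv_eq_of_mul_eq_one_left (X.r_mul_self k)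

lemma r_mem_St {x : EucSp e} {Φ : Fl e V} (h : Φ ∈ X.St x) {k : Fin (e+1)} (hk : k ∈ X.J x) :
    X.r k Φ ∈ X.St x :=
  X.St_of_agree h fun i hi => X.adj_apply Φ (fun h => hi (h ▸ hk))

lemma adj_comm {i j : Fin (e+1)} (hij : (i : ℕ) + 2 ≤ j) (Φ : Fl e V) :
    X.adj i (X.adj j Φ) = X.adj j (X.adj i Φ) := by
  -- replace the `i`-th entry of `adj j Φ` by that of `adj i Φ`
  have hne : i ≠ j := by rintro rfl; omega
  set Ψ := X.adj j Φ with hΨ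
  set Ω := X.adj i Φ with hΩ
  let f : Fin (e+1) → V := fun k => if k = i then Ω i else Ψ k
  have hfΩ : ∀ k : Fin (e+1), k ≠ j → f k = Ω k := by
    intro k hk
    by_cases hki : k = i
    · simp [f, hki]
    · simp [f, hki, hΨ, hΩ, X.adj_apply Φ hk, X.adj_apply Φ hki]
  have hfΨ : ∀ k : Fin (e+1), k ≠ i → f k = Ψ k := by
    intro k hk
    simp [f, hk]
  have hf : StrictMono f := by
    rw [Fin.strictMono_iff_lt_succ]
    intro k
    by_cases h1 : k.castSucc = j ∨ k.succ = j
    · rw [hfΨ, hfΨ]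
      · exact Ψ.2 k.castSucc_lt_succ
      · rintro rfl
        rcases h1 with h1 | h1
        · rw [← h1] at hij
          simp at hij
          omega
        · exact hne h1
      · rintro rfl
        rcases h1 with h1 | h1
        · exact hne h1
        · rw [← h1] at hij
          simp at hij
    · push Not at h1
      rw [hfΩ _ h1.1, hfΩ _ h1.2]
      exact Ω.2 k.castSucc_lt_succ
  have e1 : Fl.mk f hf = X.adj i Ψ := by
    apply X.eq_adj
    · intro h
      have : f i = Ψ i := by rw [← h]; rfl
      rw [hfΩ i hne, hΨ, X.adj_apply Φ hne] at this
      exact X.adj_ne_at i Φ this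
    · intro k hk
      exact hfΨ k hk
  have e2 : Fl.mk f hf = X.adj j Ω := by
    apply X.eq_adj
    · intro h
      have : f j = Ω j := by rw [← h]; rfl
      rw [hfΨ j hne.symm, hΩ, X.adj_apply Φ hne.symm] at this
      exact X.adj_ne_at j Φ this
    · intro k hk
      exact hfΩ k hk
  rw [← e1, e2]

lemma r_comm {i j : Fin (e+1)} (hij : (i : ℕ) + 2 ≤ j) : X.r i * X.r j = X.r j * X.r i :=
  Equiv.ext fun Φ => X.adj_comm hij Φ

end Tri
end LFC

open scoped Classical
open scoped Topology
set_option linter.unusedSectionVars false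

namespace LFC

lemma span_ne_top {e : ℕ} (S : Finset (EucSp e)) (hS : S.card ≤ e) :
    affineSpan ℝ (S : Set (EucSp e)) ≠ ⊤ := by
  intro h
  rcases S.eq_empty_or_nonempty with rfl | hne
  · simp at h
  · have h1 := finrank_vectorSpan_image_finset_le ℝ (id : EucSp e → EucSp e) S (n := S.card - 1)
      (by have := hne.card_pos; omega)
    rw [Finset.image_id, ← direction_affineSpan, h, AffineSubspace.direction_top, finrank_top] at h1
    simp at h1
    have := hne.card_pos
    omega

lemma generic {e : ℕ} {ι : Type*} [Countable ι] (S : ι → Finset (EucSp e)) (hS : ∀ i, (S i).card ≤ e)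
    {O : Set (EucSp e)} (hO : IsOpen O) (hne : O.Nonempty) :
    ∃ z ∈ O, ∀ i, z ∉ affineSpan ℝ (S i : Set (EucSp e)) := by
  by_contra hno
  push Not at hno
  have h0 : MeasureTheory.volume (⋃ i, (affineSpan ℝ (S i : Set (EucSp e)) : Set (EucSp e))) = 0 := by
    rw [MeasureTheory.measure_iUnion_null_iff]
    intro i
    exact MeasureTheory.Measure.addHaar_affineSubspace _ _ (span_ne_top _ (hS i))
  have h1 : MeasureTheory.volume O = 0 := by
    refine MeasureTheory.measure_mono_null ?_ h0
    intro z hz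
    obtain ⟨i, hi⟩ := hno z hz
    exact Set.mem_iUnion.2 ⟨i, hi⟩
  exact (hO.measure_pos _ hne).ne' h1

lemma loc_const {α : Type*} [TopologicalSpace α] {s : Set α} (hs : IsPreconnected s) (p : α → Prop)
    (h : ∀ x ∈ s, ∀ᶠ y in 𝓝[s] x, (p x ↔ p y)) {x y : α} (hx : x ∈ s) (hy : y ∈ s) (hp : p x) : p y :=
  (hs.induction₂ (fun x y => p x ↔ p y) h (fun _ _ _ _ _ _ h1 h2 => h1.trans h2)
    (fun _ _ _ _ h1 => h1.symm) hx hy).1 hp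

lemma mem_span_of_lineMap {e : ℕ} {A : AffineSubspace ℝ (EucSp e)} {x z : EucSp e} {t : ℝ} (ht : t ≠ 0)
    (hx : x ∈ A) (hy : AffineMap.lineMap x z t ∈ A) : z ∈ A := by
  have := AffineMap.lineMap_mem t⁻¹ hx hy
  rwa [AffineMap.lineMap_lineMap_right, inv_mul_cancel₀ ht, AffineMap.lineMap_apply_one] at this

namespace Tri

variable {e : ℕ} {V : Type} [PartialOrder V] (X : Tri e V)

lemma mem_affineSpan (y : EucSp e) : y ∈ affineSpan ℝ (X.b '' (X.C y)) :=
  convexHull_subset_affineSpan _ (X.mem_hull subset_rfl)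

lemma generic_pt (P : Finset (EucSp e)) {O : Set (EucSp e)} (hO : IsOpen O) (hne : O.Nonempty) :
    ∃ z ∈ O, ∀ D : Finset V, D.card + P.card ≤ e → z ∉ affineSpan ℝ (X.b '' D ∪ P) := by
  have := X.cnt
  obtain ⟨z, hz, h⟩ := generic (fun D : {D : Finset V // D.card + P.card ≤ e} => D.1.image X.b ∪ P)
    (fun D => by
      have h1 := Finset.card_union_le (D.1.image X.b) P
      have h2 := Finset.card_image_le (s := D.1) (f := X.b)
      have := D.2
      omega) hO hne
  refine ⟨z, hz, fun D hD => ?_⟩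
  have := h ⟨D, hD⟩
  simpa using this

/-- group generated by some of the adjacency permutations. -/
def Gp (L : Set (Fin (e+1))) : Subgroup (Equiv.Perm (Fl e V)) := Subgroup.closure (X.r '' L)

lemma r_mem_Gp {L : Set (Fin (e+1))} {k : Fin (e+1)} (hk : k ∈ L) : X.r k ∈ X.Gp L :=
  Subgroup.subset_closure ⟨k, hk, rfl⟩

lemma conn_small {L : Set (Fin (e+1))} {y : EucSp e} (hL : (X.J y : Set (Fin (e+1))) ⊆ L)
    (hJ : (X.J y).card ≤ 1) {Φ Ψ : Fl e V} (hΦ : Φ ∈ X.St y) (hΨ : Ψ ∈ X.St y) :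
    ∃ g ∈ X.Gp L, g Φ = Ψ := by
  by_cases hne : Ψ = Φ
  · exact ⟨1, one_mem _, hne.symm⟩
  rcases Nat.le_one_iff_eq_zero_or_eq_one.1 hJ with h | h
  · rw [Finset.card_eq_zero] at h
    exact absurd (Fl.ext' fun i => X.St_agree hΨ hΦ (by simp [h])) hne
  · obtain ⟨k, hk⟩ := Finset.card_eq_one.1 h
    refine ⟨X.r k, X.r_mem_Gp (hL (by simp [hk])), ?_⟩
    exact (X.eq_adj hne fun i hi => X.St_agree hΨ hΦ (by simpa [hk] using hi)).symm

lemma conn {N : Set (EucSp e)} (hN : Convex ℝ N) (hNo : IsOpen N) {L : Set (Fin (e+1))}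
    (hL : ∀ y ∈ N, (X.J y : Set (Fin (e+1))) ⊆ L) {Φ Ψ : Fl e V} (hΦ : (N ∩ X.O Φ).Nonempty)
    (hΨ : (N ∩ X.O Ψ).Nonempty) : ∃ g ∈ X.Gp L, g Φ = Ψ := by
  obtain ⟨x, hxN, hx⟩ := hΦ
  obtain ⟨z, ⟨hzN, hz⟩, hgen⟩ := X.generic_pt {x} (hNo.inter (X.isOpen_O Ψ)) hΨ
  have hxC : X.C x = Φ.fs := hx
  have hzC : X.C z = Ψ.fs := hz
  have hseg : ∀ t ∈ Set.Icc (0:ℝ) 1, AffineMap.lineMap x z t ∈ N := fun t ht =>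
    hN.segment_subset hxN hzN (by rw [segment_eq_image_lineMap]; exact ⟨t, ht, rfl⟩)
  have hcard : ∀ t ∈ Set.Icc (0:ℝ) 1, (X.J (AffineMap.lineMap x z t)).card ≤ 1 := by
    intro t _
    by_cases ht : t = 0
    · subst ht
      rw [AffineMap.lineMap_apply_zero, X.J_of_eq hxC]
      simp
    · by_contra hlt
      have hc := X.card_J (AffineMap.lineMap x z t)
      refine hgen (X.C (AffineMap.lineMap x z t)) (by simp; omega) ?_
      refine mem_span_of_lineMap ht (x := x) (subset_affineSpan ℝ _ (by simp)) ?_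
      exact affineSpan_mono ℝ Set.subset_union_left (X.mem_affineSpan _)
  have key := loc_const (isPreconnected_Icc (a := (0:ℝ)) (b := 1))
    (fun t => ∀ Ω ∈ X.St (AffineMap.lineMap x z t), ∃ g ∈ X.Gp L, g Φ = Ω) ?_
    (x := 0) (y := 1) (by simp) (by simp) ?_
  · refine key Ψ ?_
    rw [AffineMap.lineMap_apply_one, X.St_of_eq hzC]
    rfl
  · intro t ht
    have hcont : Continuous (fun t : ℝ => AffineMap.lineMap x z t) := AffineMap.lineMap_continuous
    have := hcont.continuousAt.eventually (X.semicont (AffineMap.lineMap x z t))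
    filter_upwards [nhdsWithin_le_nhds this] with s hs
    have hst := X.St_anti hs
    constructor
    · intro h Ω hΩ
      exact h Ω (hst hΩ)
    · intro h Ω hΩ
      obtain ⟨Ω', hΩ'⟩ := X.St_nonempty (AffineMap.lineMap x z s)
      obtain ⟨g, hg, h1⟩ := h Ω' hΩ'
      obtain ⟨g', hg', h2⟩ := X.conn_small (hL _ (hseg t ht)) (hcard t ht) (hst hΩ') hΩ
      exact ⟨g' * g, mul_mem hg' hg, by rw [Equiv.Perm.mul_apply, h1, h2]⟩
  · intro Ω hΩ
    rw [AffineMap.lineMap_apply_zero, X.St_of_eq hxC] at hΩ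
    exact ⟨1, one_mem _, hΩ.symm⟩

lemma exists_ball (q : EucSp e) : ∃ ε > 0, ∀ y ∈ Metric.ball q ε, X.C q ⊆ X.C y :=
  Metric.eventually_nhds_iff_ball.1 (X.semicont q)

lemma conn_St {q : EucSp e} {Φ Ψ : Fl e V} (hΦ : Φ ∈ X.St q) (hΨ : Ψ ∈ X.St q) :
    ∃ g ∈ X.Gp (X.J q), g Φ = Ψ := by
  obtain ⟨ε, hε, h⟩ := X.exists_ball q
  exact X.conn (convex_ball q ε) Metric.isOpen_ball (fun y hy => by exact_mod_cast X.J_anti (h y hy))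
    (X.near_O hΦ (Metric.ball_mem_nhds q hε)) (X.near_O hΨ (Metric.ball_mem_nhds q hε))

lemma conn_all (Φ Ψ : Fl e V) : ∃ g ∈ X.Gp Set.univ, g Φ = Ψ :=
  X.conn convex_univ isOpen_univ (fun _ _ => Set.subset_univ _)
    (by simpa using X.O_nonempty Φ) (by simpa using X.O_nonempty Ψ)

lemma Gp_iff {L : Set (Fin (e+1))} {P : Fl e V → Prop} (h : ∀ Φ, ∀ k ∈ L, P Φ → P (X.r k Φ))
    {g : Equiv.Perm (Fl e V)} (hg : g ∈ X.Gp L) : ∀ Φ, P Φ ↔ P (g Φ) := by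
  induction hg using Subgroup.closure_induction with
  | mem g hg =>
    obtain ⟨k, hk, rfl⟩ := hg
    intro Φ
    refine ⟨h Φ k hk, fun h' => ?_⟩
    have := h _ k hk h'
    rwa [r_apply, r_apply, X.adj_adj] at this
  | one => exact fun Φ => Iff.rfl
  | mul g g' _ _ h1 h2 => exact fun Φ => (h2 Φ).trans (h1 (g' Φ))
  | inv g _ h1 => 
    intro Φ
    have := h1 (g⁻¹ Φ)
    have e1 : g (g⁻¹ Φ) = Φ := g.apply_symm_apply Φ
    rw [e1] at this
    exact this.symm

lemma conn_induct {P : Fl e V → Prop} (h : ∀ Φ k, P Φ → P (X.r k Φ)) {Φ : Fl e V} (hΦ : P Φ)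
    (Ψ : Fl e V) : P Ψ := by
  obtain ⟨g, hg, rfl⟩ := X.conn_all Φ Ψ
  exact (X.Gp_iff (fun Φ k _ => h Φ k) hg Φ).1 hΦ

end Tri
end LFC

open scoped Classical
open scoped Topology
set_option linter.unusedSectionVars false

namespace LFC

section dihedral
variable {G : Type*} [Group G] {a b : G}

lemma dih_conj (ha : a * a = 1) (hb : b * b = 1) (m : ℤ) : a * (a * b) ^ m = (a * b) ^ (-m) * a := by
  have ha' : a⁻¹ = a := inv_eq_of_mul_eq_one_left ha
  have hb' : b⁻¹ = b := inv_eq_of_mul_eq_one_left hb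
  have h1 : a * (a * b) * a⁻¹ = (a * b)⁻¹ := by
    rw [mul_inv_rev, ha', hb', ← mul_assoc, ha, one_mul]
  have h2 : a * (a * b) ^ m * a⁻¹ = ((a * b)⁻¹) ^ m := by rw [← conj_zpow, h1]
  rw [inv_zpow', mul_inv_eq_iff_eq_mul] at h2
  exact h2

lemma dih_conj' (ha : a * a = 1) (hb : b * b = 1) (m : ℤ) : b * (a * b) ^ m = (a * b) ^ (-m) * b := by
  have ha' : a⁻¹ = a := inv_eq_of_mul_eq_one_left ha
  have hb' : b⁻¹ = b := inv_eq_of_mul_eq_one_left hb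
  have h1 : b * (a * b) * b⁻¹ = (a * b)⁻¹ := by
    rw [mul_inv_rev, ha', hb', mul_assoc, mul_assoc, hb, mul_one]
  have h2 : b * (a * b) ^ m * b⁻¹ = ((a * b)⁻¹) ^ m := by rw [← conj_zpow, h1]
  rw [inv_zpow', mul_inv_eq_iff_eq_mul] at h2
  exact h2

lemma dih_form (ha : a * a = 1) (hb : b * b = 1) {g : G} (hg : g ∈ Subgroup.closure {a, b}) :
    ∃ m : ℤ, g = (a * b) ^ m ∨ g = (a * b) ^ m * a := by
  have hc := dih_conj ha hb
  induction hg using Subgroup.closure_induction with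
  | mem g hg =>
    rcases hg with rfl | hg
    · exact ⟨0, Or.inr (by simp)⟩
    · have hg : g = b := hg
      subst hg
      refine ⟨-1, Or.inr ?_⟩
      have h1 := hc 1
      rw [zpow_one, ← mul_assoc, ha, one_mul] at h1
      exact h1
  | one => exact ⟨0, Or.inl (by simp)⟩
  | mul g h _ _ h1 h2 =>
    obtain ⟨m, rfl | rfl⟩ := h1 <;> obtain ⟨n, rfl | rfl⟩ := h2
    · exact ⟨m + n, Or.inl (zpow_add _ _ _).symm⟩
    · exact ⟨m + n, Or.inr (by rw [zpow_add, mul_assoc])⟩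
    · exact ⟨m + -n, Or.inr (by rw [mul_assoc, hc, zpow_add, mul_assoc])⟩
    · exact ⟨m + -n, Or.inl (by rw [mul_assoc, ← mul_assoc a, hc, mul_assoc _ a a, ha, mul_one, zpow_add])⟩
  | inv g _ h1 =>
    obtain ⟨m, rfl | rfl⟩ := h1
    · exact ⟨-m, Or.inl (zpow_neg _ _).symm⟩
    · refine ⟨m, Or.inr ?_⟩
      rw [mul_inv_rev, ← zpow_neg, inv_eq_of_mul_eq_one_left ha, hc, neg_neg]

lemma dih_refl (ha : a * a = 1) (hb : b * b = 1) (m : ℤ) :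
    ∃ h : G, (a * b) ^ m * a = h * a * h⁻¹ ∨ (a * b) ^ m * a = h * b * h⁻¹ := by
  rcases Int.even_or_odd' m with ⟨n, rfl | rfl⟩
  · refine ⟨(a * b) ^ n, Or.inl ?_⟩
    rw [← zpow_neg, mul_assoc, dih_conj ha hb, neg_neg, ← mul_assoc, ← zpow_add, two_mul]
  · refine ⟨(a * b) ^ (n + 1), Or.inr ?_⟩
    rw [← zpow_neg, mul_assoc, dih_conj' ha hb, neg_neg, ← mul_assoc, ← zpow_add]
    have : n + 1 + (n + 1) = (2 * n + 1) + 1 := by ring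
    rw [this, zpow_add _ (2 * n + 1) 1, zpow_one, mul_assoc _ (a * b) b, mul_assoc a, hb, mul_one]

end dihedral

namespace Tri

variable {e : ℕ} {V : Type} [PartialOrder V] (X : Tri e V)

lemma r_ne (k : Fin (e+1)) (Φ : Fl e V) : X.r k Φ ≠ Φ := X.adj_ne k Φ

/-- Regularity of facets and vertex figures in terms of stabilisers. -/
structure Reg : Prop where
  ne_two : e ≠ 2
  tile : ∀ Φ Ψ : Fl e V, Φ (Fin.last e) = Ψ (Fin.last e) → ∀ g ∈ X.Gp {k | k ≠ Fin.last e},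
    g Φ = Φ → g Ψ = Ψ
  vert : ∀ Φ Ψ : Fl e V, Φ 0 = Ψ 0 → ∀ g ∈ X.Gp {k | k ≠ 0}, g Φ = Φ → g Ψ = Ψ

variable {X}

lemma rot_step (H : X.Reg) {i j : Fin (e+1)} (hij : i < j) (m : ℤ) (Φ : Fl e V) (k : Fin (e+1))
    (hΦ : ((X.r i * X.r j) ^ m) Φ = Φ) : ((X.r i * X.r j) ^ m) (X.r k Φ) = X.r k Φ := by
  have hinv : ((X.r i * X.r j) ^ (-m)) Φ = Φ := by
    rw [zpow_neg]
    exact (Equiv.symm_apply_eq ((X.r i * X.r j) ^ m)).2 hΦ.symm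
  have hcomm : X.r k * X.r i = X.r i * X.r k → X.r k * X.r j = X.r j * X.r k →
      ((X.r i * X.r j) ^ m) (X.r k Φ) = X.r k Φ := by
    intro h1 h2
    have hc : Commute (X.r k) (X.r i * X.r j) := Commute.mul_right h1 h2
    have := (hc.zpow_right m).eq
    rw [← Equiv.Perm.mul_apply, ← this, Equiv.Perm.mul_apply, hΦ]
  by_cases hki : k = i
  · subst hki
    have := dih_conj (X.r_mul_self k) (X.r_mul_self j) (-m)
    rw [neg_neg] at this
    rw [← Equiv.Perm.mul_apply, ← this, Equiv.Perm.mul_apply, hinv]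
  by_cases hkj : k = j
  · subst hkj
    have := dih_conj' (X.r_mul_self i) (X.r_mul_self k) (-m)
    rw [neg_neg] at this
    rw [← Equiv.Perm.mul_apply, ← this, Equiv.Perm.mul_apply, hinv]
  have hki' : (k : ℕ) ≠ i := fun h => hki (Fin.ext h)
  have hkj' : (k : ℕ) ≠ j := fun h => hkj (Fin.ext h)
  have hij' : (i : ℕ) < j := hij
  have hmem : ∀ L : Set (Fin (e+1)), i ∈ L → j ∈ L → (X.r i * X.r j) ^ m ∈ X.Gp L := fun L h1 h2 =>
    zpow_mem (mul_mem (X.r_mem_Gp h1) (X.r_mem_Gp h2)) m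
  have hk2 := k.2
  have hj2 := j.2
  have hi2 := i.2
  by_cases hfar : (i : ℕ) + 2 ≤ j
  · have h1 := X.r_comm hfar
    have hsq : (X.r i * X.r j) * (X.r i * X.r j) = 1 := by
      calc (X.r i * X.r j) * (X.r i * X.r j) = (X.r i * X.r j) * (X.r j * X.r i) := by rw [h1]
        _ = X.r i * (X.r j * X.r j) * X.r i := by simp only [mul_assoc]
        _ = 1 := by rw [X.r_mul_self, mul_one, X.r_mul_self]
    rcases Int.even_or_odd' m with ⟨n, rfl | rfl⟩
    · rw [zpow_mul, zpow_two, hsq, one_zpow]; rfl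
    · exfalso
      rw [zpow_add, zpow_mul, zpow_two, hsq, one_zpow, one_mul, zpow_one, Equiv.Perm.mul_apply] at hΦ
      have h2 : X.r j Φ = X.r i Φ := by
        have := congrArg (X.r i) hΦ
        rwa [r_apply, r_apply, X.adj_adj] at this
      have h3 : X.adj j Φ i = X.adj i Φ i := by rw [← r_apply, ← r_apply, h2]
      rw [X.adj_apply Φ hij.ne] at h3
      exact X.adj_ne_at i Φ h3.symm
  by_cases hT : (j : ℕ) < e ∧ (k : ℕ) < e
  · refine H.tile Φ _ ?_ _ (hmem _ ?_ ?_) hΦ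
    · exact (X.adj_apply Φ (fun h => by rw [← h] at hT; simp at hT)).symm
    · intro h; rw [h] at hij'; simp at hij'; omega
    · intro h; rw [h] at hT; simp at hT
  by_cases hV : 0 < (i : ℕ) ∧ 0 < (k : ℕ)
  · refine H.vert Φ _ ?_ _ (hmem _ ?_ ?_) hΦ
    · exact (X.adj_apply Φ (fun h => by rw [← h] at hV; simp at hV)).symm
    · intro h; rw [h] at hV; simp at hV
    · intro h; rw [h] at hij'; simp at hij'
  have h2 := H.ne_two
  by_cases hk0 : (k : ℕ) = 0
  · exact hcomm (X.r_comm (by omega)) (X.r_comm (by omega))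
  · exact hcomm (X.r_comm (by omega)).symm (X.r_comm (by omega)).symm

lemma free (H : X.Reg) {L : Finset (Fin (e+1))} (hL : L.card ≤ 2) {g : Equiv.Perm (Fl e V)}
    (hg : g ∈ X.Gp L) {Φ : Fl e V} (hΦ : g Φ = Φ) (Ψ : Fl e V) : g Ψ = Ψ := by
  obtain ⟨L', hLL, hL'⟩ := Finset.exists_superset_card_eq hL (by have := X.epos; simp; omega)
  obtain ⟨i, j, hij, rfl⟩ : ∃ i j : Fin (e+1), i < j ∧ L' = {i, j} := by
    obtain ⟨i, j, hij, rfl⟩ := Finset.card_eq_two.1 hL'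
    rcases lt_or_gt_of_ne hij with h | h
    · exact ⟨i, j, h, rfl⟩
    · exact ⟨j, i, h, Finset.pair_comm _ _⟩
  have hg' : g ∈ Subgroup.closure {X.r i, X.r j} := by
    refine Subgroup.closure_mono ?_ hg
    rintro _ ⟨k, hk, rfl⟩
    have := hLL hk
    simp only [Finset.mem_insert, Finset.mem_singleton] at this
    rcases this with rfl | rfl <;> simp
  obtain ⟨m, rfl | rfl⟩ := dih_form (X.r_mul_self i) (X.r_mul_self j) hg'
  · exact X.conn_induct (P := fun Ψ => ((X.r i * X.r j) ^ m) Ψ = Ψ)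
      (fun Φ k h => rot_step H hij m Φ k h) hΦ Ψ
  · exfalso
    have hfix : ∀ (h : Equiv.Perm (Fl e V)) k, (h * X.r k * h⁻¹) Φ ≠ Φ := by
      intro h k hh
      apply X.r_ne k (h⁻¹ Φ)
      rw [mul_assoc, Equiv.Perm.mul_apply, Equiv.Perm.mul_apply] at hh
      exact ((Equiv.symm_apply_eq h).2 hh.symm).symm
    obtain ⟨h, h1 | h1⟩ := dih_refl (X.r_mul_self i) (X.r_mul_self j) m
    · rw [h1] at hΦ; exact hfix h i hΦ
    · rw [h1] at hΦ; exact hfix h j hΦ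

end Tri
end LFC

open scoped Classical
open scoped Topology
set_option linter.unusedSectionVars false

namespace LFC
namespace Tri

variable {e : ℕ} {V : Type} [PartialOrder V] (X : Tri e V)

/-- Local equivariance at a point. -/
def Equi (q : EucSp e) (φ : Fl e V → Fl e V) : Prop :=
  ∀ Ω ∈ X.St q, ∀ k ∈ X.J q, φ (X.r k Ω) = X.r k (φ Ω)

lemma Equi.anti {X : Tri e V} {x y : EucSp e} {φ : Fl e V → Fl e V} (h : X.Equi x φ)
    (hxy : X.C x ⊆ X.C y) : X.Equi y φ :=
  fun Ω hΩ k hk => h Ω (X.St_anti hxy hΩ) k (X.J_anti hxy hk)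

lemma Equi.uniq {X : Tri e V} {q : EucSp e} {φ ψ : Fl e V → Fl e V} (hφ : X.Equi q φ)
    (hψ : X.Equi q ψ) {Φ : Fl e V} (hΦ : Φ ∈ X.St q) (h : φ Φ = ψ Φ) {Ω : Fl e V}
    (hΩ : Ω ∈ X.St q) : φ Ω = ψ Ω := by
  obtain ⟨g, hg, rfl⟩ := X.conn_St hΦ hΩ
  refine ((X.Gp_iff (P := fun Ω => Ω ∈ X.St q ∧ φ Ω = ψ Ω) ?_ hg Φ).1 ⟨hΦ, h⟩).2
  rintro Ω k hk ⟨h1, h2⟩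
  exact ⟨X.r_mem_St h1 hk, by rw [hφ Ω h1 k hk, hψ Ω h1 k hk, h2]⟩

variable {X}

lemma local_ext (H : X.Reg) {q : EucSp e} (hq : (X.J q).card ≤ 2) {Φ : Fl e V} (hΦ : Φ ∈ X.St q)
    (Ψ : Fl e V) : ∃ φ : Fl e V → Fl e V, X.Equi q φ ∧ φ Φ = Ψ := by
  have hex : ∀ Ω, ∃ Θ : Fl e V, ∀ g ∈ X.Gp (X.J q), g Φ = Ω → g Ψ = Θ := by
    intro Ω
    by_cases h : ∃ g ∈ X.Gp (X.J q), g Φ = Ω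
    · obtain ⟨g, hg, rfl⟩ := h
      refine ⟨g Ψ, fun g' hg' he => ?_⟩
      have h1 : (g⁻¹ * g') Φ = Φ := (Equiv.symm_apply_eq g).2 he
      have h2 := free H hq (mul_mem (inv_mem hg) hg') h1 Ψ
      exact (Equiv.symm_apply_eq g).1 h2
    · push Not at h
      exact ⟨Ψ, fun g hg he => absurd he (h g hg)⟩
  choose φ hφ using hex
  refine ⟨φ, ?_, (hφ Φ 1 (one_mem _) rfl).symm⟩
  intro Ω hΩ k hk
  obtain ⟨g, hg, rfl⟩ := X.conn_St hΦ hΩ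
  rw [← hφ _ g hg rfl]
  exact (hφ (X.r k (g Φ)) (X.r k * g) (mul_mem (X.r_mem_Gp hk) hg) rfl).symm

variable (X)

/-- Sections of the sheaf of locally equivariant maps, along `c`. -/
def IsSec {α : Type*} [TopologicalSpace α] (c : α → EucSp e) (I : Set α)
    (s : α → Fl e V → Fl e V) : Prop :=
  ∀ t ∈ I, X.Equi (c t) (s t) ∧ ∀ᶠ t' in 𝓝 t, t' ∈ I → ∀ Ω ∈ X.St (c t'), s t' Ω = s t Ω

variable {X}

lemma IsSec.mono {α : Type*} [TopologicalSpace α] {c : α → EucSp e} {I I' : Set α}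
    {s : α → Fl e V → Fl e V} (h : X.IsSec c I s) (hI : I' ⊆ I) : X.IsSec c I' s := by
  intro t ht
  refine ⟨(h t (hI ht)).1, ?_⟩
  filter_upwards [(h t (hI ht)).2] with t' h' ht'
  exact h' (hI ht')

lemma IsSec.const {α : Type*} [TopologicalSpace α] {c : α → EucSp e} {I : Set α}
    {φ : Fl e V → Fl e V} (h : ∀ t ∈ I, X.Equi (c t) φ) : X.IsSec c I (fun _ => φ) :=
  fun t ht => ⟨h t ht, Filter.Eventually.of_forall fun _ _ _ _ => rfl⟩

lemma IsSec.agree {α : Type*} [TopologicalSpace α] {c : α → EucSp e} (hc : Continuous c) {I : Set α}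
    (hI : IsPreconnected I) {s₁ s₂ : α → Fl e V → Fl e V} (h₁ : X.IsSec c I s₁) (h₂ : X.IsSec c I s₂)
    {t₀ : α} (ht₀ : t₀ ∈ I) (h0 : ∀ Ω ∈ X.St (c t₀), s₁ t₀ Ω = s₂ t₀ Ω) {t : α} (ht : t ∈ I) :
    ∀ Ω ∈ X.St (c t), s₁ t Ω = s₂ t Ω := by
  refine loc_const hI (fun t => ∀ Ω ∈ X.St (c t), s₁ t Ω = s₂ t Ω) ?_ ht₀ ht h0
  intro t ht
  filter_upwards [nhdsWithin_le_nhds (hc.continuousAt.eventually (X.semicont (c t))),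
    nhdsWithin_le_nhds (h₁ t ht).2, nhdsWithin_le_nhds (h₂ t ht).2, self_mem_nhdsWithin]
    with t' hC h1 h2 ht'
  have hst := X.St_anti hC
  constructor
  · intro h Ω hΩ
    rw [h1 ht' Ω hΩ, h2 ht' Ω hΩ, h Ω (hst hΩ)]
  · intro h Ω hΩ
    obtain ⟨Θ, hΘ⟩ := X.St_nonempty (c t')
    refine (h₁ t ht).1.uniq (h₂ t ht).1 (hst hΘ) ?_ hΩ
    rw [← h1 ht' Θ hΘ, ← h2 ht' Θ hΘ, h Θ hΘ]

lemma sec_extend {c : ℝ → EucSp e} (hc : Continuous c) (H : X.Reg) {a a' : ℝ} (ha : 0 ≤ a) {q : EucSp e}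
    (hq : (X.J q).card ≤ 2) (hnear : ∀ t ∈ Set.Icc a a', X.C q ⊆ X.C (c t)) (haa : a ≤ a')
    {s : ℝ → Fl e V → Fl e V} (hs : X.IsSec c (Set.Icc 0 a) s) :
    ∃ s', X.IsSec c (Set.Icc 0 a') s' ∧ s' 0 = s 0 := by
  obtain ⟨Θ, hΘ⟩ := X.St_nonempty (c a)
  have hCa := hnear a ⟨le_rfl, haa⟩
  obtain ⟨φ, hφ, hφΘ⟩ := local_ext H hq (X.St_anti hCa hΘ) (s a Θ)
  have haI : a ∈ Set.Icc 0 a := ⟨ha, le_rfl⟩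
  have hφa : ∀ Ω ∈ X.St (c a), φ Ω = s a Ω := fun Ω hΩ =>
    (hφ.anti hCa).uniq (hs a haI).1 hΘ hφΘ hΩ
  refine ⟨fun t => if t ≤ a then s t else φ, ?_, by simp [ha]⟩
  intro t ht
  rcases lt_trichotomy t a with h | h | h
  · have htI : t ∈ Set.Icc 0 a := ⟨ht.1, h.le⟩
    refine ⟨by simpa only [if_pos h.le] using (hs t htI).1, ?_⟩
    filter_upwards [(hs t htI).2, gt_mem_nhds h] with t' h1 h2 ht'
    simp only [if_pos h.le, if_pos (le_of_lt h2)]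
    exact h1 ⟨ht'.1, le_of_lt h2⟩
  · subst h
    refine ⟨by simpa only [if_pos le_rfl] using (hs t haI).1, ?_⟩
    filter_upwards [(hs t haI).2, hc.continuousAt.eventually (X.semicont (c t))] with t' h1 h2 ht' Ω hΩ
    by_cases hle : t' ≤ t
    · simp only [if_pos le_rfl, if_pos hle]
      exact h1 ⟨ht'.1, hle⟩ Ω hΩ
    · simp only [if_pos le_rfl, if_neg hle]
      exact hφa Ω (X.St_anti h2 hΩ)
  · refine ⟨?_, ?_⟩
    · simp only [if_neg (not_le.2 h)]
      exact hφ.anti (hnear t ⟨h.le, ht.2⟩)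
    · filter_upwards [lt_mem_nhds h] with t' h1 _ Ω _
      simp only [if_neg (not_le.2 h), if_neg (not_le.2 h1)]

lemma sec_path {c : ℝ → EucSp e} (hc : Continuous c) (H : X.Reg)
    (hgood : ∀ t ∈ Set.Icc (0:ℝ) 1, (X.J (c t)).card ≤ 2) {φ : Fl e V → Fl e V} (hφ : X.Equi (c 0) φ) :
    ∃ s, X.IsSec c (Set.Icc 0 1) s ∧ s 0 = φ := by
  refine loc_const (isPreconnected_Icc (a := (0:ℝ)) (b := 1))
    (fun a => ∃ s, X.IsSec c (Set.Icc 0 a) s ∧ s 0 = φ) ?_ (x := 0) (by simp) (by simp) ?_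
  · intro a₀ ha₀
    obtain ⟨δ, hδ, hball⟩ := Metric.eventually_nhds_iff_ball.1
      (hc.continuousAt.eventually (X.semicont (c a₀)))
    have main : ∀ a ∈ Metric.ball a₀ δ, ∀ a' ∈ Metric.ball a₀ δ, 0 ≤ a → 
        (∃ s, X.IsSec c (Set.Icc 0 a) s ∧ s 0 = φ) → ∃ s, X.IsSec c (Set.Icc 0 a') s ∧ s 0 = φ := by
      rintro a ha a' ha' h0 ⟨s, hs, hs0⟩
      rcases le_total a a' with h | h
      · obtain ⟨s', h1, h2⟩ := sec_extend hc H h0 (hgood a₀ ha₀) (a' := a') 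
          (fun t ht => hball t ((convex_ball a₀ δ).ordConnected.out ha ha' ht)) h hs
        exact ⟨s', h1, h2.trans hs0⟩
      · exact ⟨s, hs.mono (Set.Icc_subset_Icc_right h), hs0⟩
    filter_upwards [nhdsWithin_le_nhds (Metric.ball_mem_nhds a₀ hδ), self_mem_nhdsWithin] with a ha haI
    exact ⟨main a₀ (Metric.mem_ball_self hδ) a ha ha₀.1, main a ha a₀ (Metric.mem_ball_self hδ) haI.1⟩
  · refine ⟨fun _ => φ, IsSec.const ?_, rfl⟩
    intro t ht
    have : t = 0 := le_antisymm ht.2 ht.1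
    rwa [this]

variable (X)

/-- Points visible from `p` in the complement of the codimension 3 skeleton. -/
def U (p : EucSp e) : Set (EucSp e) :=
  {x | ∀ t ∈ Set.Icc (0:ℝ) 1, (X.J (AffineMap.lineMap p x t)).card ≤ 2}

lemma generic_pt2 (P Q : Finset (EucSp e)) {O : Set (EucSp e)} (hO : IsOpen O) (hne : O.Nonempty) :
    ∃ z ∈ O, (∀ D : Finset V, D.card + P.card ≤ e → z ∉ affineSpan ℝ (X.b '' D ∪ P)) ∧
      (∀ D : Finset V, D.card + Q.card ≤ e → z ∉ affineSpan ℝ (X.b '' D ∪ Q)) := by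
  have := X.cnt
  obtain ⟨z, hz, h⟩ := generic (Sum.elim
    (fun D : {D : Finset V // D.card + P.card ≤ e} => D.1.image X.b ∪ P)
    (fun D : {D : Finset V // D.card + Q.card ≤ e} => D.1.image X.b ∪ Q))
    (by
      rintro (D | D)
      · have h1 := Finset.card_union_le (D.1.image X.b) P
        have h2 := Finset.card_image_le (s := D.1) (f := X.b)
        have := D.2
        simp only [Sum.elim_inl]
        omega
      · have h1 := Finset.card_union_le (D.1.image X.b) Q
        have h2 := Finset.card_image_le (s := D.1) (f := X.b)
        have := D.2
        simp only [Sum.elim_inr]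
        omega) hO hne
  refine ⟨z, hz, fun D hD => ?_, fun D hD => ?_⟩
  · simpa using h (Sum.inl ⟨D, hD⟩)
  · simpa using h (Sum.inr ⟨D, hD⟩)

lemma visible {p x z : EucSp e} (hx : x ∈ X.U p)
    (hz : ∀ D : Finset V, D.card + ({p, x} : Finset (EucSp e)).card ≤ e →
      z ∉ affineSpan ℝ (X.b '' D ∪ ({p, x} : Finset (EucSp e)))) (t : ℝ) :
    AffineMap.lineMap x z t ∈ X.U p := by
  by_cases ht : t = 0
  · rwa [ht, AffineMap.lineMap_apply_zero]
  intro s hs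
  by_cases hs0 : s = 0
  · have := hx 0 (by simp)
    rw [AffineMap.lineMap_apply_zero] at this
    rwa [hs0, AffineMap.lineMap_apply_zero]
  by_contra hlt
  set y := AffineMap.lineMap p (AffineMap.lineMap x z t) s with hy
  have hc := X.card_J y
  have h2 := Finset.card_le_two (a := p) (b := x)
  refine hz (X.C y) (by omega) ?_
  refine mem_span_of_lineMap ht (x := x) (subset_affineSpan ℝ _ (by simp)) ?_
  refine mem_span_of_lineMap hs0 (x := p) (subset_affineSpan ℝ _ (by simp)) ?_
  exact affineSpan_mono ℝ Set.subset_union_left (X.mem_affineSpan _)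

lemma lemN {p x₁ x₂ : EucSp e} (h₁ : x₁ ∈ X.U p) (h₂ : x₂ ∈ X.U p) {O : Set (EucSp e)} (hO : IsOpen O)
    (hne : O.Nonempty) : ∃ z ∈ O, (∀ t : ℝ, AffineMap.lineMap x₁ z t ∈ X.U p) ∧
      (∀ t : ℝ, AffineMap.lineMap x₂ z t ∈ X.U p) := by
  obtain ⟨z, hz, hz1, hz2⟩ := X.generic_pt2 {p, x₁} {p, x₂} hO hne
  exact ⟨z, hz, fun t => X.visible h₁ hz1 t, fun t => X.visible h₂ hz2 t⟩

lemma mem_U_self {p : EucSp e} {Φ : Fl e V} (hp : p ∈ X.O Φ) : p ∈ X.U p := by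
  intro t _
  rw [AffineMap.lineMap_same_apply, X.J_of_eq hp]
  simp

lemma U_dense {p : EucSp e} {Φ : Fl e V} (hp : p ∈ X.O Φ) {O : Set (EucSp e)} (hO : IsOpen O)
    (hne : O.Nonempty) : ∃ z ∈ O, z ∈ X.U p := by
  obtain ⟨z, hz, h, _⟩ := X.lemN (X.mem_U_self hp) (X.mem_U_self hp) hO hne
  exact ⟨z, hz, by simpa using h 1⟩

variable {X}

lemma ev_semicont (X : Tri e V) {α : Type*} [TopologicalSpace α] {c : α → EucSp e} (hc : Continuous c) (a : α) :
    ∀ᶠ z in 𝓝 a, X.C (c a) ⊆ X.C (c z) := hc.continuousAt.eventually (X.semicont (c a))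

lemma sec_U (H : X.Reg) {p : EucSp e} {Φ₀ : Fl e V} (hp : p ∈ X.O Φ₀) (Ψ₀ : Fl e V) :
    ∃ S : EucSp e → Fl e V → Fl e V, X.IsSec id (X.U p) S ∧ S p Φ₀ = Ψ₀ := by
  have hc : ∀ x : EucSp e, Continuous (fun t : ℝ => AffineMap.lineMap p x t) := fun x =>
    AffineMap.lineMap_continuous
  have hc2 : Continuous (fun z : EucSp e × ℝ => AffineMap.lineMap p z.1 z.2) := by
    simp only [AffineMap.lineMap_apply_module]
    fun_prop
  have hex : ∀ x : EucSp e, ∃ s : ℝ → Fl e V → Fl e V, x ∈ X.U p →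
      X.IsSec (fun t : ℝ => AffineMap.lineMap p x t) (Set.Icc 0 1) s ∧ s 0 = fun _ => Ψ₀ := by
    intro x
    by_cases hx : x ∈ X.U p
    · obtain ⟨s, h⟩ := sec_path (hc x) H hx (φ := fun _ => Ψ₀) (by
        intro Ω _ k hk
        rw [AffineMap.lineMap_apply_zero, X.J_of_eq hp] at hk
        simp at hk)
      exact ⟨s, fun _ => h⟩
    · exact ⟨fun _ => id, fun h => absurd h hx⟩
  choose s hs using hex
  refine ⟨fun x => s x 1, ?_, ?_⟩
  · intro x hx
    have h1I : (1:ℝ) ∈ Set.Icc (0:ℝ) 1 := by simp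
    refine ⟨by simpa using ((hs x hx).1 1 h1I).1, ?_⟩
    have key := loc_const (isPreconnected_Icc (a := (0:ℝ)) (b := 1))
      (fun t => ∀ᶠ y in 𝓝 x, y ∈ X.U p → ∀ Ω ∈ X.St (AffineMap.lineMap p y t), s y t Ω = s x t Ω)
      ?_ (x := 0) (y := 1) (by simp) (by simp) ?_
    · simpa using key
    · intro t₀ ht₀
      obtain ⟨q, hq⟩ : ∃ q, q = AffineMap.lineMap p x t₀ := ⟨_, rfl⟩
      have hev : ∀ᶠ z : EucSp e × ℝ in 𝓝 (x, t₀), X.C q ⊆ X.C (AffineMap.lineMap p z.1 z.2) := by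
        rw [hq]
        exact
          X.ev_semicont hc2 (x, t₀)
      rw [nhds_prod_eq] at hev
      obtain ⟨pa, hpa, pb, hpb, hab⟩ := Filter.eventually_prod_iff.1 hev
      obtain ⟨δ, hδ, hball⟩ := Metric.eventually_nhds_iff_ball.1 hpb
      set φ := s x t₀ with hφ
      have hφq : X.Equi q φ := by
        rw [hq]
        exact ((hs x hx).1 t₀ ht₀).1
      set I : Set ℝ := Metric.ball t₀ δ ∩ Set.Icc 0 1 with hI
      have hIp : IsPreconnected I := ((convex_ball t₀ δ).inter (convex_Icc 0 1)).isPreconnected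
      have ht₀I : t₀ ∈ I := ⟨Metric.mem_ball_self hδ, ht₀⟩
      have hconst : ∀ y, pa y → X.IsSec (fun t : ℝ => AffineMap.lineMap p y t) I (fun _ => φ) :=
        fun y hy => IsSec.const fun t ht => hφq.anti (hab hy (hball t ht.1))
      have hsx : ∀ t ∈ I, ∀ Ω ∈ X.St (AffineMap.lineMap p x t), s x t Ω = φ Ω := fun t ht =>
        IsSec.agree (hc x) hIp ((hs x hx).1.mono Set.inter_subset_right) (hconst x hpa.self_of_nhds)
          ht₀I (fun Ω _ => rfl) ht
      have hiff : ∀ t ∈ I, ((∀ᶠ y in 𝓝 x, y ∈ X.U p → ∀ Ω ∈ X.St (AffineMap.lineMap p y t), s y t Ω = s x t Ω)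
          ↔ ∀ᶠ y in 𝓝 x, y ∈ X.U p → ∀ Ω ∈ X.St (AffineMap.lineMap p y t), s y t Ω = φ Ω) := by
        intro t ht
        have hcy : Continuous (fun y : EucSp e => AffineMap.lineMap p y t) := by
          simp only [AffineMap.lineMap_apply_module]
          fun_prop
        have hev2 : ∀ᶠ y in 𝓝 x, X.C (AffineMap.lineMap p x t) ⊆ X.C (AffineMap.lineMap p y t) :=
          X.ev_semicont hcy x
        apply Filter.eventually_congr
        filter_upwards [hev2] with y hy
        refine imp_congr_right fun _ => forall₂_congr fun Ω hΩ => ?_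
        rw [hsx t ht Ω (X.St_anti hy hΩ)]
      have hmove : ∀ t ∈ I, ∀ t' ∈ I,
          (∀ᶠ y in 𝓝 x, y ∈ X.U p → ∀ Ω ∈ X.St (AffineMap.lineMap p y t), s y t Ω = φ Ω) →
          ∀ᶠ y in 𝓝 x, y ∈ X.U p → ∀ Ω ∈ X.St (AffineMap.lineMap p y t'), s y t' Ω = φ Ω := by
        intro t ht t' ht' h
        filter_upwards [h, hpa] with y hy hya hyU
        exact IsSec.agree (hc y) hIp ((hs y hyU).1.mono Set.inter_subset_right) (hconst y hya)
          ht (hy hyU) ht'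
      filter_upwards [nhdsWithin_le_nhds (Metric.ball_mem_nhds t₀ hδ), self_mem_nhdsWithin] with t ht htI
      rw [hiff t ⟨ht, htI⟩, hiff t₀ ht₀I]
      exact ⟨hmove _ ht₀I _ ⟨ht, htI⟩, hmove _ ⟨ht, htI⟩ _ ht₀I⟩
    · filter_upwards with y hy Ω _
      rw [(hs y hy).2, (hs x hx).2]
  · have hpU := X.mem_U_self hp
    have h1 := hs p hpU
    have := IsSec.agree (hc p) isPreconnected_Icc h1.1 (IsSec.const (φ := fun _ => Ψ₀) ?_) (t₀ := 0) (by simp)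
      (fun Ω _ => by rw [h1.2]) (t := 1) (by simp) Φ₀ ?_
    · exact this
    · intro t _ Ω _ k hk
      rw [AffineMap.lineMap_same_apply, X.J_of_eq hp] at hk
      simp at hk
    · rw [AffineMap.lineMap_same_apply, X.St_of_eq hp]
      rfl

lemma seg_preconn (x z : EucSp e) : IsPreconnected (segment ℝ x z) := (convex_segment x z).isPreconnected

/-- The monodromy theorem for flags. -/
lemma exists_equivariant (H : X.Reg) (Φ₀ Ψ₀ : Fl e V) :
    ∃ f : Fl e V → Fl e V, f Φ₀ = Ψ₀ ∧ ∀ k Φ, f (X.r k Φ) = X.r k (f Φ) := by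
  obtain ⟨p, hp⟩ := X.O_nonempty Φ₀
  obtain ⟨S, hS, hS0⟩ := sec_U H hp Ψ₀
  have hseg : ∀ x z : EucSp e, (∀ t : ℝ, AffineMap.lineMap x z t ∈ X.U p) → segment ℝ x z ⊆ X.U p := by
    intro x z h y hy
    rw [segment_eq_image_lineMap] at hy
    obtain ⟨t, _, rfl⟩ := hy
    exact h t
  have hU : ∀ Φ, ∃ z ∈ X.O Φ, z ∈ X.U p := fun Φ => X.U_dense hp (X.isOpen_O Φ) (X.O_nonempty Φ)
  choose ζ hζO hζU using hU
  have hloc : ∀ Φ x z, x ∈ X.O Φ → z ∈ X.O Φ → segment ℝ x z ⊆ X.U p → S x Φ = S z Φ := by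
    intro Φ x z hx hz hxz
    have hO := (X.convex_O Φ).segment_subset hx hz
    have hst : ∀ y ∈ segment ℝ x z, X.St y = {Φ} := fun y hy => X.St_of_eq (hO hy)
    refine (IsSec.agree continuous_id (seg_preconn x z) (hS.mono hxz)
      (IsSec.const (φ := S x) ?_) (left_mem_segment ℝ x z) (fun _ _ => rfl) (right_mem_segment ℝ x z) Φ ?_).symm
    · intro y hy Ω _ k hk
      rw [id, X.J_of_eq (hO hy)] at hk
      simp at hk
    · rw [id, hst z (right_mem_segment ℝ x z)]
      rfl
  have hind : ∀ Φ x, x ∈ X.O Φ → x ∈ X.U p → S x Φ = S (ζ Φ) Φ := by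
    intro Φ x hx hxU
    obtain ⟨z, hz, h1, h2⟩ := X.lemN hxU (hζU Φ) (X.isOpen_O Φ) (X.O_nonempty Φ)
    rw [hloc Φ x z hx hz (hseg _ _ h1), hloc Φ _ z (hζO Φ) hz (hseg _ _ h2)]
  refine ⟨fun Φ => S (ζ Φ) Φ, ?_, ?_⟩
  · show S (ζ Φ₀) Φ₀ = Ψ₀
    rw [← hind Φ₀ p hp (X.mem_U_self hp), hS0]
  · intro k Φ
    show S (ζ (X.r k Φ)) (X.r k Φ) = X.r k (S (ζ Φ) Φ)
    set w := X.q Φ k with hw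
    obtain ⟨ε, hε, hball⟩ := X.exists_ball w
    have hΦw : Φ ∈ X.St w := X.mem_St_q Φ k
    have hkw : k ∈ X.J w := by rw [hw, X.J_q]; simp
    have hrw : X.r k Φ ∈ X.St w := X.r_mem_St hΦw hkw
    have hopen : ∀ Ω, IsOpen (Metric.ball w ε ∩ X.O Ω) := fun Ω => Metric.isOpen_ball.inter (X.isOpen_O Ω)
    obtain ⟨x, ⟨hxN, hxO⟩, hxU⟩ := X.U_dense hp (hopen Φ) (X.near_O hΦw (Metric.ball_mem_nhds w hε))
    obtain ⟨z, ⟨hzN, hzO⟩, hz, _⟩ := X.lemN hxU hxU (hopen (X.r k Φ))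
      (X.near_O hrw (Metric.ball_mem_nhds w hε))
    have hxz := hseg _ _ hz
    obtain ⟨φ, hφ, hφΦ⟩ := local_ext H (q := w) (by rw [hw, X.J_q]; simp) hΦw (S x Φ)
    have hN := (convex_ball w ε).segment_subset hxN hzN
    have := IsSec.agree continuous_id (seg_preconn x z) (hS.mono hxz)
      (IsSec.const (φ := φ) fun y hy => hφ.anti (hball y (hN hy))) (left_mem_segment ℝ x z)
      (by
        intro Ω hΩ
        rw [id, X.St_of_eq hxO] at hΩ
        rw [show Ω = Φ from hΩ, hφΦ]) (right_mem_segment ℝ x z) (X.r k Φ)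
      (by rw [id, X.St_of_eq hzO]; rfl)
    rw [← hind _ z hzO (hxz (right_mem_segment ℝ x z)), ← hind _ x hxO hxU, this,
      hφ Φ hΦw k hkw, hφΦ]

end Tri
end LFC

open scoped Classical
open scoped Topology
set_option linter.unusedSectionVars false

namespace LFC
namespace Tri

variable {e : ℕ} {V : Type} [PartialOrder V] (X : Tri e V)

lemma exists_flag_le (X : Tri e V) {F G : V} (h : F ≤ G) : ∃ (Φ : Fl e V) (i j : Fin (e+1)), i ≤ j ∧ Φ i = F ∧ Φ j = G := by
  obtain ⟨Φ, hΦ⟩ := X.exists_flag (D := {F, G}) (by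
    simp only [Finset.coe_insert, Finset.coe_singleton]
    exact IsChain.pair h)
  obtain ⟨i, hi⟩ := Fl.mem_fs.1 (hΦ (show F ∈ ({F, G} : Finset V) by simp))
  obtain ⟨j, hj⟩ := Fl.mem_fs.1 (hΦ (show G ∈ ({F, G} : Finset V) by simp))
  refine ⟨Φ, i, j, ?_, hi, hj⟩
  rw [← hi, ← hj] at h
  exact Φ.2.le_iff_le.1 h

lemma idx_eq (X : Tri e V) {Φ Ψ : Fl e V} {i j : Fin (e+1)} (h : Φ i = Ψ j) : i = j := by
  have h1 := X.rk_flag Φ i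
  rw [h, X.rk_flag] at h1
  exact Fin.ext h1.symm

lemma f_const {f : Fl e V → Fl e V} (hf : ∀ k Φ, f (X.r k Φ) = X.r k (f Φ)) {Φ Ψ : Fl e V}
    {k : Fin (e+1)} (h : Φ k = Ψ k) : f Φ k = f Ψ k := by
  have hC := X.C_b (Φ k)
  have h1 : Φ ∈ X.St (X.b (Φ k)) := by
    show X.C _ ⊆ _
    rw [hC, Finset.singleton_subset_iff]
    exact Fl.mem_fs.2 ⟨k, rfl⟩
  have h2 : Ψ ∈ X.St (X.b (Φ k)) := by
    show X.C _ ⊆ _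
    rw [hC, Finset.singleton_subset_iff]
    exact Fl.mem_fs.2 ⟨k, h.symm⟩
  obtain ⟨g, hg, rfl⟩ := X.conn_St h1 h2
  refine ((X.Gp_iff (P := fun Ω => f Φ k = f Ω k) ?_ hg Φ).1 rfl)
  intro Ω j hj hΩ
  have hjk : k ≠ j := by
    rintro rfl
    exact X.mem_J.1 hj (Φ k) (by rw [hC]; simp) (X.rk_flag Φ k)
  rw [hf, r_apply, X.adj_apply _ hjk]
  exact hΩ

lemma exists_map {f : Fl e V → Fl e V} (hf : ∀ k Φ, f (X.r k Φ) = X.r k (f Φ)) :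
    ∃ γ : V → V, Monotone γ ∧ ∀ Φ k, γ (Φ k) = f Φ k := by
  have hex : ∀ F : V, ∃ (Φ : Fl e V) (i : Fin (e+1)), Φ i = F := fun F => by
    obtain ⟨Φ, i, j, _, h, _⟩ := X.exists_flag_le (le_refl F)
    exact ⟨Φ, i, h⟩
  choose Φ i h using hex
  have key : ∀ Ω k, f (Φ (Ω k)) (i (Ω k)) = f Ω k := by
    intro Ω k
    have h1 : i (Ω k) = k := X.idx_eq (h (Ω k))
    rw [h1]
    refine X.f_const hf ?_
    conv_rhs => rw [← h (Ω k), h1]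
  refine ⟨fun F => f (Φ F) (i F), ?_, key⟩
  intro F G hFG
  obtain ⟨Ω, a, b, hab, rfl, rfl⟩ := X.exists_flag_le hFG
  show f (Φ (Ω a)) (i (Ω a)) ≤ f (Φ (Ω b)) (i (Ω b))
  rw [key, key]
  exact (f Ω).2.monotone hab

lemma transitive {X : Tri e V} (H : X.Reg) (Φ Ψ : Fl e V) : ∃ γ : V ≃o V, ∀ k, γ (Φ k) = Ψ k := by
  obtain ⟨f, hf0, hf⟩ := exists_equivariant H Φ Ψ
  obtain ⟨g, hg0, hg⟩ := exists_equivariant H Ψ Φ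
  have hgf : ∀ Ω, g (f Ω) = Ω := by
    refine X.conn_induct (P := fun Ω => g (f Ω) = Ω) ?_ (Φ := Φ) (by rw [hf0, hg0])
    intro Ω k h
    rw [hf, hg, h]
  have hfg : ∀ Ω, f (g Ω) = Ω := by
    refine X.conn_induct (P := fun Ω => f (g Ω) = Ω) ?_ (Φ := Ψ) (by rw [hg0, hf0])
    intro Ω k h
    rw [hg, hf, h]
  obtain ⟨γ, hγ, hγf⟩ := X.exists_map hf
  obtain ⟨δ, hδ, hδg⟩ := X.exists_map hg
  have h1 : ∀ F, δ (γ F) = F := by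
    intro F
    obtain ⟨Ω, i, j, _, rfl, _⟩ := X.exists_flag_le (le_refl F)
    rw [hγf, hδg, hgf]
  have h2 : ∀ F, γ (δ F) = F := by
    intro F
    obtain ⟨Ω, i, j, _, rfl, _⟩ := X.exists_flag_le (le_refl F)
    rw [hδg, hγf, hfg]
  refine ⟨⟨⟨γ, δ, h1, h2⟩, ?_⟩, ?_⟩
  · intro F G
    constructor
    · intro h
      have := hδ h
      simpa [h1] using this
    · intro h
      exact hγ h
  · intro k
    show γ (Φ k) = Ψ k
    rw [hγf, hf0]

end Tri
end LFC

open scoped Classical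
open scoped Topology
set_option linter.unusedSectionVars false

namespace LFC

section abstract_part

variable {α β : Type} [PartialOrder α] [PartialOrder β]

lemma isBot_iso (γ : β ≃o β) (x : β) : IsBot (γ x) ↔ IsBot x := by
  constructor
  · intro h y
    exact γ.le_iff_le.1 (h (γ y))
  · intro h y
    rw [← γ.apply_symm_apply y]
    exact γ.le_iff_le.2 (h _)

lemma isTop_iso (γ : β ≃o β) (x : β) : IsTop (γ x) ↔ IsTop x := by
  constructor
  · intro h y
    exact γ.le_iff_le.1 (h (γ y))
  · intro h y
    rw [← γ.apply_symm_apply y]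
    exact γ.le_iff_le.2 (h _)

/-- The flag of `β` obtained from a maximal chain of `α`. -/
lemma flag_of_chain (ι : α ↪o β) (hcmp : ∀ x ∉ Set.range ι, IsBot x ∨ IsTop x) {S : Set α}
    (hS : IsMaxChain (· ≤ ·) S) : ∃ Φ : Flag β, (Φ : Set β) = ι '' S ∪ (Set.range ι)ᶜ := by
  have htot : ∀ x ∉ Set.range ι, ∀ y, x ≤ y ∨ y ≤ x := fun x hx y =>
    (hcmp x hx).elim (fun h => Or.inl (h y)) (fun h => Or.inr (h y))
  refine ⟨⟨ι '' S ∪ (Set.range ι)ᶜ, ?_, ?_⟩, rfl⟩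
  · rintro x (⟨a, ha, rfl⟩ | hx) y (⟨b, hb, rfl⟩ | hy) _
    · exact (hS.1.total ha hb).imp ι.le_iff_le.2 ι.le_iff_le.2
    · exact (htot y hy _).symm
    · exact htot x hx _
    · exact htot x hx _
  · intro s hs hsub
    refine subset_antisymm hsub ?_
    intro x hx
    by_cases hr : x ∈ Set.range ι
    · obtain ⟨a, rfl⟩ := hr
      left
      refine ⟨a, ?_, rfl⟩
      have h1 : IsChain (· ≤ ·) (ι ⁻¹' s) := by
        intro a ha b hb _
        exact (hs.total ha hb).imp ι.le_iff_le.1 ι.le_iff_le.1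
      have h2 : S ⊆ ι ⁻¹' s := fun a ha => hsub (Or.inl ⟨a, ha, rfl⟩)
      rw [hS.2 h1 h2]
      exact hx
    · exact Or.inr hr

lemma chain_of_flag (ι : α ↪o β) (hcmp : ∀ x ∉ Set.range ι, IsBot x ∨ IsTop x) (Φ : Flag β) :
    IsMaxChain (· ≤ ·) (ι ⁻¹' (Φ : Set β)) ∧
      (Φ : Set β) = ι '' (ι ⁻¹' (Φ : Set β)) ∪ (Set.range ι)ᶜ := by
  have htot : ∀ x ∉ Set.range ι, ∀ y, x ≤ y ∨ y ≤ x := fun x hx y =>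
    (hcmp x hx).elim (fun h => Or.inl (h y)) (fun h => Or.inr (h y))
  have hsub : (Set.range ι)ᶜ ⊆ (Φ : Set β) := by
    intro x hx
    have hch : IsChain (· ≤ ·) (insert x (Φ : Set β)) :=
      Φ.Chain'.insert fun b _ _ => htot x hx b
    have h2 := Φ.max_chain' hch (Set.subset_insert _ _)
    have h3 : x ∈ insert x (Φ : Set β) := Set.mem_insert _ _
    rw [← h2] at h3
    exact h3
  refine ⟨⟨?_, ?_⟩, ?_⟩
  · intro a ha b hb _
    exact (Φ.Chain'.total ha hb).imp ι.le_iff_le.1 ι.le_iff_le.1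
  · intro s hs hss
    refine subset_antisymm hss ?_
    intro a ha
    have hch : IsChain (· ≤ ·) (insert (ι a) (Φ : Set β)) := by
      refine Φ.Chain'.insert fun b hb _ => ?_
      by_cases hr : b ∈ Set.range ι
      · obtain ⟨c, rfl⟩ := hr
        exact (hs.total ha (hss hb)).imp ι.le_iff_le.2 ι.le_iff_le.2
      · exact (htot b hr _).symm
    have h2 := Φ.max_chain' hch (Set.subset_insert _ _)
    have h3 : ι a ∈ insert (ι a) (Φ : Set β) := Set.mem_insert _ _
    rw [← h2] at h3
    exact h3
  · ext x
    constructor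
    · intro hx
      by_cases hr : x ∈ Set.range ι
      · obtain ⟨c, rfl⟩ := hr
        exact Or.inl ⟨c, hx, rfl⟩
      · exact Or.inr hr
    · rintro (⟨c, hc, rfl⟩ | h)
      · exact hc
      · exact hsub h

lemma descend (ι : α ↪o β) (hcmp : ∀ x ∉ Set.range ι, IsBot x ∨ IsTop x)
    (hinv : ∀ (γ : β ≃o β) x, x ∈ Set.range ι ↔ γ x ∈ Set.range ι)
    (hβ : MaxChainTransitive β) {n : ℕ} {φ ψ : Fin n → α} (hφ : StrictMono φ) (hψ : StrictMono ψ)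
    (hφm : IsMaxChain (· ≤ ·) (Set.range φ)) (hψm : IsMaxChain (· ≤ ·) (Set.range ψ)) :
    ∃ γ : α ≃o α, ∀ i, γ (φ i) = ψ i := by
  obtain ⟨Φ, hΦ⟩ := flag_of_chain ι hcmp hφm
  obtain ⟨Ψ, hΨ⟩ := flag_of_chain ι hcmp hψm
  obtain ⟨γ, hγ⟩ := hβ Φ Ψ
  have h1 : ∀ a, ∃ b, ι b = γ (ι a) := fun a => (hinv γ (ι a)).1 ⟨a, rfl⟩
  have h2 : ∀ a, ∃ b, ι b = γ.symm (ι a) := fun a => (hinv γ.symm (ι a)).1 ⟨a, rfl⟩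
  choose f hf using h1
  choose g hg using h2
  let δ : α ≃o α := ⟨⟨f, g, fun a => ι.injective (by rw [hg, hf, γ.symm_apply_apply]),
    fun a => ι.injective (by rw [hf, hg, γ.apply_symm_apply])⟩, by
      intro a b
      rw [← ι.le_iff_le, ← ι.le_iff_le (a := a)]
      show ι (f a) ≤ ι (f b) ↔ _
      rw [hf, hf, γ.le_iff_le]⟩
  refine ⟨δ, ?_⟩
  have hsm : StrictMono (fun i => δ (φ i)) := fun i j h => δ.strictMono (hφ h)
  have hmem : ∀ i, δ (φ i) ∈ Set.range ψ := by
    intro i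
    have h3 : γ (ι (φ i)) ∈ (Ψ : Set β) := by
      rw [← hγ]
      refine ⟨_, ?_, rfl⟩
      rw [hΦ]
      exact Or.inl ⟨_, ⟨i, rfl⟩, rfl⟩
    rw [hΨ, ← hf] at h3
    rcases h3 with ⟨c, hc, h⟩ | h
    · have := ι.injective h
      rw [this] at hc
      exact hc
    · exact absurd ⟨_, rfl⟩ h
  have hrange : Set.range (fun i => δ (φ i)) = Set.range ψ := by
    have hsub : Set.range (fun i => δ (φ i)) ⊆ Set.range ψ := by
      rintro _ ⟨i, rfl⟩
      exact hmem i
    apply Set.eq_of_subset_of_ncard_le hsub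
    rw [← Set.image_univ, ← Set.image_univ, Set.ncard_image_of_injective _ hsm.injective,
      Set.ncard_image_of_injective _ hψ.injective]
  intro i
  exact congrFun ((StrictMono.range_inj hsm hψ).1 hrange) i

lemma extend_mono (ι : α ↪o β) (hcmp : ∀ x ∉ Set.range ι, IsBot x ∨ IsTop x) (γ : α ≃o α) :
    ∃ f : β → β, Monotone f ∧ (∀ a, f (ι a) = ι (γ a)) ∧ ∀ x ∉ Set.range ι, f x = x := by
  have hex : ∀ x, ∃ y, (∀ a, x = ι a → y = ι (γ a)) ∧ (x ∉ Set.range ι → y = x) := by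
    intro x
    by_cases hr : x ∈ Set.range ι
    · obtain ⟨c, rfl⟩ := hr
      refine ⟨ι (γ c), ?_, fun h => absurd ⟨c, rfl⟩ h⟩
      intro a h
      rw [ι.injective h]
    · exact ⟨x, fun a h => absurd ⟨a, h.symm⟩ hr, fun _ => rfl⟩
  choose f hf1 hf2 using hex
  refine ⟨f, ?_, fun a => hf1 _ a rfl, hf2⟩
  intro x y hxy
  by_cases hx : x ∈ Set.range ι
  · by_cases hy : y ∈ Set.range ι
    · obtain ⟨a, rfl⟩ := hx
      obtain ⟨b, rfl⟩ := hy
      rw [hf1 _ a rfl, hf1 _ b rfl]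
      exact ι.le_iff_le.2 (γ.le_iff_le.2 (ι.le_iff_le.1 hxy))
    · rw [hf2 y hy]
      rcases hcmp y hy with h | h
      · rw [le_antisymm hxy (h x), hf2 y hy]
      · exact h _
  · rw [hf2 x hx]
    rcases hcmp x hx with h | h
    · exact h _
    · rw [← le_antisymm hxy (h y), hf2 x hx]

lemma extend_iso (ι : α ↪o β) (hcmp : ∀ x ∉ Set.range ι, IsBot x ∨ IsTop x) (γ : α ≃o α) :
    ∃ f : β ≃o β, (∀ a, f (ι a) = ι (γ a)) ∧ ∀ x ∉ Set.range ι, f x = x := by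
  obtain ⟨f, hf, hf1, hf2⟩ := extend_mono ι hcmp γ
  obtain ⟨g, hg, hg1, hg2⟩ := extend_mono ι hcmp γ.symm
  have h1 : ∀ x, g (f x) = x := by
    intro x
    by_cases hx : x ∈ Set.range ι
    · obtain ⟨a, rfl⟩ := hx
      rw [hf1, hg1, γ.symm_apply_apply]
    · rw [hf2 x hx, hg2 x hx]
  have h2 : ∀ x, f (g x) = x := by
    intro x
    by_cases hx : x ∈ Set.range ι
    · obtain ⟨a, rfl⟩ := hx
      rw [hg1, hf1, γ.apply_symm_apply]
    · rw [hg2 x hx, hf2 x hx]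
  refine ⟨⟨⟨f, g, h1, h2⟩, ?_⟩, hf1, hf2⟩
  intro x y
  refine ⟨fun h => ?_, fun h => hf h⟩
  have := hg h
  simpa [h1] using this

end abstract_part

namespace Tri
variable {e : ℕ} {V : Type} [PartialOrder V] 

lemma maxChain (X : Tri e V) (Φ : Fl e V) : IsMaxChain (· ≤ ·) (Set.range Φ) := by
  refine ⟨Φ.2.monotone.isChain_range, ?_⟩
  intro s hs hsub
  refine subset_antisymm hsub ?_
  intro x hx
  have hch : IsChain (· ≤ ·) ((insert x Φ.fs : Finset V) : Set V) := by
    refine hs.mono ?_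
    intro y hy
    rcases Finset.mem_insert.1 (Finset.mem_coe.1 hy) with rfl | h
    · exact hx
    · exact hsub (Fl.mem_fs.1 h)
  have := X.fs_eq_of_subset hch (Finset.subset_insert _ _)
  have h2 : x ∈ insert x Φ.fs := Finset.mem_insert_self _ _
  rw [this] at h2
  exact Fl.mem_fs.1 h2

lemma flag_of_maxChain (X : Tri e V) {S : Set V} (hS : IsMaxChain (· ≤ ·) S) :
    ∃ Φ : Fl e V, S = Set.range Φ := by
  have hfin : S.Finite := by
    refine Set.Finite.of_finite_image (f := X.rk) ?_ (X.rk_injOn hS.1)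
    refine (Set.finite_Iic e).subset ?_
    rintro _ ⟨F, _, rfl⟩
    exact X.rk_le F
  obtain ⟨Φ, hΦ⟩ := X.exists_flag (D := hfin.toFinset) (by simpa using hS.1)
  refine ⟨Φ, hS.2 Φ.2.monotone.isChain_range ?_⟩
  intro x hx
  exact Fl.mem_fs.1 (hΦ (by simpa using hx))

lemma maxChain_sub (X : Tri e V) (A : Set V) (Φ : Fl e V) (hΦ : ∀ i, Φ i ∈ A) :
    IsMaxChain (· ≤ ·) (Set.range (fun i => (⟨Φ i, hΦ i⟩ : A))) := by
  refine ⟨?_, ?_⟩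
  · have : Monotone (fun i => (⟨Φ i, hΦ i⟩ : A)) := fun i j h => Φ.2.monotone h
    exact this.isChain_range
  intro s hs hsub
  refine subset_antisymm hsub ?_
  intro x hx
  have hch : IsChain (· ≤ ·) (Subtype.val '' s) := by
    rintro _ ⟨a, ha, rfl⟩ _ ⟨b, hb, rfl⟩ _
    exact hs.total ha hb
  have h1 : Set.range Φ ⊆ Subtype.val '' s := by
    rintro _ ⟨i, rfl⟩
    exact ⟨_, hsub ⟨i, rfl⟩, rfl⟩
  have h2 := (X.maxChain Φ).2 hch h1
  have h3 : x.1 ∈ Subtype.val '' s := ⟨x, hx, rfl⟩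
  rw [← h2] at h3
  obtain ⟨i, hi⟩ := h3
  exact ⟨i, Subtype.ext hi⟩

lemma reg_of_iso (X : Tri e V) (A : Set V) (γ : A ≃o A) (L : Set (Fin (e+1))) {Φ Ψ : Fl e V}
    (hΦ : ∀ i, Φ i ∈ A) (hγ : ∀ i, (γ ⟨Φ i, hΦ i⟩).1 = Ψ i)
    (hL : ∀ Ω : Fl e V, (∀ i, Ω i ∈ A) → ∀ k ∈ L, ∀ i, X.r k Ω i ∈ A)
    {g : Equiv.Perm (Fl e V)} (hg : g ∈ X.Gp L) (hfix : g Φ = Φ) : g Ψ = Ψ := by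
  let Rel : Fl e V → Fl e V → Prop := fun Ω Ω' => ∃ h : ∀ i, Ω i ∈ A, ∀ i, (γ ⟨Ω i, h i⟩).1 = Ω' i
  have step : ∀ k ∈ L, ∀ Ω Ω', Rel Ω Ω' → Rel (X.r k Ω) (X.r k Ω') := by
    rintro k hk Ω Ω' ⟨h, h'⟩
    have hA := hL Ω h k hk
    refine ⟨hA, ?_⟩
    let Θ : Fl e V := Fl.mk (fun i => (γ ⟨X.r k Ω i, hA i⟩).1) (fun i j hij =>
      γ.strictMono (a := ⟨X.r k Ω i, hA i⟩) (b := ⟨X.r k Ω j, hA j⟩) ((X.r k Ω).2 hij))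
    have hΘ : Θ = X.adj k Ω' := by
      refine X.eq_adj ?_ ?_
      · intro heq
        apply X.adj_ne k Ω
        apply Fl.ext'
        intro i
        have h1 : (γ ⟨X.r k Ω i, hA i⟩).1 = (γ ⟨Ω i, h i⟩).1 := by
          rw [h' i, ← heq]
          rfl
        have h2 := γ.injective (Subtype.ext h1)
        exact congrArg Subtype.val h2
      · intro i hi
        rw [← h' i]
        show (γ ⟨X.r k Ω i, hA i⟩).1 = _
        have : (⟨X.r k Ω i, hA i⟩ : A) = ⟨Ω i, h i⟩ := Subtype.ext (X.adj_apply Ω hi)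
        rw [this]
    intro i
    exact congrArg (fun Ξ : Fl e V => Ξ i) hΘ
  have main : ∀ g ∈ X.Gp L, ∀ Ω Ω', Rel Ω Ω' ↔ Rel (g Ω) (g Ω') := by
    intro g hg
    induction hg using Subgroup.closure_induction with
    | mem g hg =>
      obtain ⟨k, hk, rfl⟩ := hg
      intro Ω Ω'
      refine ⟨step k hk Ω Ω', fun h => ?_⟩
      have := step k hk _ _ h
      rwa [r_apply, r_apply, r_apply, r_apply, adj_adj, adj_adj] at this
    | one => exact fun _ _ => Iff.rfl
    | mul g g' _ _ h1 h2 => exact fun Ω Ω' => (h2 Ω Ω').trans (h1 (g' Ω) (g' Ω'))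
    | inv g _ h1 =>
      intro Ω Ω'
      have := h1 (g⁻¹ Ω) (g⁻¹ Ω')
      have e1 : g (g⁻¹ Ω) = Ω := g.apply_symm_apply Ω
      have e2 : g (g⁻¹ Ω') = Ω' := g.apply_symm_apply Ω'
      rw [e1, e2] at this
      exact this.symm
  obtain ⟨h, h'⟩ := (main g hg Φ Ψ).1 ⟨hΦ, hγ⟩
  apply Fl.ext'
  intro i
  rw [← h' i, ← hγ i]
  have : (⟨g Φ i, h i⟩ : A) = ⟨Φ i, hΦ i⟩ := Subtype.ext (congrArg (fun Ξ : Fl e V => Ξ i) hfix)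
  rw [this]

end Tri
end LFC

open scoped Classical
open scoped Topology
set_option linter.unusedSectionVars false

namespace LFC

variable {e : ℕ} {T : Set (Set (EucSp e))}

lemma rep_top (hT : IsLFCTiling T) {w : NF T →₀ ℝ} {x : EucSp e} (hw : IsRep (bc hT) w x) :
    ∃ F : NF T, x ∈ F.s ∧ ∀ G ∈ w.support, G ≤ F := by
  have hne : w.support.Nonempty := by
    by_contra h
    rw [Finset.not_nonempty_iff_eq_empty, Finsupp.support_eq_empty] at h
    have := hw.mass_one
    rw [h, mass_eq_sum] at this
    simp at this
  obtain ⟨F, hF, htop⟩ := exists_top hw.chain hne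
  refine ⟨F, ?_, htop⟩
  have := (rep_mem_core hT hw.nonneg hF htop).2.1
  rwa [hw.mass_one, inv_one, one_smul, hw.sum_eq] at this

/-- The triangulation of space by barycentric subdivision. -/
noncomputable def tri (hT : IsLFCTiling T) (he : 1 ≤ e) : Tri e (NF T) where
  epos := he
  b := bc hT
  rk := rk
  rk_mono := rk_strictMono hT
  rk_le := rk_le
  cnt := countable_NF hT
  ex := fun x => by
    obtain ⟨F, hF⟩ := exists_car hT x
    obtain ⟨w, hw, _⟩ := rep_exists_aux hT (rk F) F x le_rfl hF
    exact ⟨w, hw⟩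
  uniq := fun x w v hw hv => rep_unique hT hw hv
  lf := fun x => by
    refine ⟨Metric.ball x 1, Metric.ball_mem_nhds x one_pos, ?_⟩
    refine (locally_finite_faces hT (Metric.isBounded_ball (x := x) (r := 1))).subset ?_
    rintro G ⟨y, hy, w, hw, hG⟩
    obtain ⟨F, hyF, htop⟩ := rep_top hT hw
    obtain ⟨t, ht, hexp⟩ := F.exists_tile
    exact ⟨t, ht, ((NF.le_iff _ _).1 (htop G hG)).trans hexp.subset, y, hexp.subset hyF, hy⟩

lemma tile_of_last (hT : IsLFCTiling T) (he : 1 ≤ e) (Φ : Fl e (NF T)) : (Φ (Fin.last e)).s ∈ T := by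
  obtain ⟨t, ht, hexp⟩ := (Φ (Fin.last e)).exists_tile
  have hne : t.Nonempty := (Φ (Fin.last e)).nonempty.mono hexp.subset
  let G : NF T := NF.mk' ht (IsExposed.refl t) hne
  have hle : Φ (Fin.last e) ≤ G := hexp.subset
  have heq : Φ (Fin.last e) = G := by
    by_contra hcon
    have h1 := rk_strictMono hT (lt_of_le_of_ne hle hcon)
    have h2 := (tri hT he).rk_flag Φ (Fin.last e)
    have h3 : rk (Φ (Fin.last e)) = e := h2
    have := rk_le G
    omega
  rw [heq]
  exact ht

lemma setRank_of_zero (hT : IsLFCTiling T) (he : 1 ≤ e) (Φ : Fl e (NF T)) : setRank (Φ 0).1.1 = 0 := by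
  have h2 : rk (Φ 0) = ((0 : Fin (e+1)) : ℕ) := (tri hT he).rk_flag Φ 0
  rw [Fin.val_zero] at h2
  unfold setRank
  rw [if_neg (Φ 0).2.ne_empty]
  exact_mod_cast h2

lemma reg_tile (hT : IsLFCTiling T) (he : 1 ≤ e)
    (htile : ∀ F : TFace T, F.1 ∈ T →
      MaxChainTransitive {G : TPoset T // G ≤ (F : TPoset T)}) (Φ Ψ : Fl e (NF T))
    (h : Φ (Fin.last e) = Ψ (Fin.last e)) (g : Equiv.Perm (Fl e (NF T)))
    (hg : g ∈ (tri hT he).Gp {k | k ≠ Fin.last e}) (hfix : g Φ = Φ) : g Ψ = Ψ := by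
  obtain ⟨t, ht⟩ : ∃ t, t = Φ (Fin.last e) := ⟨_, rfl⟩
  have htT : t.1.1 ∈ T := by rw [ht]; exact tile_of_last hT he Φ
  have hΦ : ∀ i, Φ i ∈ Set.Iic t := fun i => by rw [ht]; exact Φ.2.monotone (Fin.le_last i)
  have hΨ : ∀ i, Ψ i ∈ Set.Iic t := fun i => by rw [ht, h]; exact Ψ.2.monotone (Fin.le_last i)
  let ι : Set.Iic t ↪o {G : TPoset T // G ≤ (t.1 : TPoset T)} :=
    OrderEmbedding.ofMapLEIff (fun a => ⟨(a.1.1 : TPoset T), WithTop.coe_le_coe.2 a.2⟩)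
      (fun a b => WithTop.coe_le_coe)
  have hr : ∀ x, x ∈ Set.range ι ↔ ¬ IsBot x := by
    rintro ⟨x, hx⟩
    obtain ⟨G, rfl⟩ : ∃ G : TFace T, x = (G : TPoset T) := by
      induction x using WithTop.recTopCoe with
      | top => exact absurd (top_le_iff.1 hx) (WithTop.coe_ne_top)
      | coe G => exact ⟨G, rfl⟩
    constructor
    · rintro ⟨a, ha⟩ hbot
      rw [← ha] at hbot
      let E : TFace T := ⟨∅, t.1.1, htT, isExposed_empty⟩
      have hE : (E : TPoset T) ≤ (t.1 : TPoset T) := WithTop.coe_le_coe.2 (Set.empty_subset _)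
      have h1 : (a.1.1 : TPoset T) ≤ (E : TPoset T) := hbot ⟨(E : TPoset T), hE⟩
      have h3 : a.1.1 ≤ E := WithTop.coe_le_coe.1 h1
      have h2 : a.1.1.1 ⊆ ∅ := h3
      exact a.1.2.ne_empty (Set.subset_empty_iff.1 h2)
    · intro hbot
      by_cases hG : G.1.Nonempty
      · exact ⟨⟨⟨G, hG⟩, WithTop.coe_le_coe.1 hx⟩, rfl⟩
      · exfalso
        apply hbot
        rintro ⟨y, hy⟩
        induction y using WithTop.recTopCoe with
        | top => exact absurd (top_le_iff.1 hy) (WithTop.coe_ne_top)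
        | coe H =>
          refine WithTop.coe_le_coe.2 (show G.1 ⊆ H.1 from ?_)
          rw [Set.not_nonempty_iff_eq_empty.1 hG]
          exact Set.empty_subset _
  obtain ⟨γ, hγ⟩ := descend ι (fun x hx => Or.inl (by rw [hr] at hx; exact not_not.1 hx))
    (fun γ x => by rw [hr, hr, isBot_iso]) (htile t.1 htT)
    (φ := fun i => (⟨Φ i, hΦ i⟩ : Set.Iic t)) (ψ := fun i => (⟨Ψ i, hΨ i⟩ : Set.Iic t))
    (fun i j hij => Φ.2 hij) (fun i j hij => Ψ.2 hij)
    ((tri hT he).maxChain_sub _ Φ hΦ) ((tri hT he).maxChain_sub _ Ψ hΨ)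
  refine (tri hT he).reg_of_iso (Set.Iic t) γ _ hΦ (fun i => congrArg Subtype.val (hγ i)) ?_ hg hfix
  intro Ω hΩ k hk i
  have h1 : (tri hT he).r k Ω (Fin.last e) = Ω (Fin.last e) := (tri hT he).adj_apply Ω (Ne.symm hk)
  exact (((tri hT he).r k Ω).2.monotone (Fin.le_last i)).trans (h1.le.trans (hΩ _))

lemma reg_vert (hT : IsLFCTiling T) (he : 1 ≤ e)
    (hvert : ∀ v : TFace T, setRank v.1 = 0 →
      MaxChainTransitive {G : TPoset T // (v : TPoset T) ≤ G}) (Φ Ψ : Fl e (NF T))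
    (h : Φ 0 = Ψ 0) (g : Equiv.Perm (Fl e (NF T)))
    (hg : g ∈ (tri hT he).Gp {k | k ≠ 0}) (hfix : g Φ = Φ) : g Ψ = Ψ := by
  obtain ⟨t, ht⟩ : ∃ t, t = Φ 0 := ⟨_, rfl⟩
  have htT : setRank t.1.1 = 0 := by rw [ht]; exact setRank_of_zero hT he Φ
  have hΦ : ∀ i, Φ i ∈ Set.Ici t := fun i => by rw [ht]; exact Φ.2.monotone (Fin.zero_le i)
  have hΨ : ∀ i, Ψ i ∈ Set.Ici t := fun i => by rw [ht, h]; exact Ψ.2.monotone (Fin.zero_le i)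
  let ι : Set.Ici t ↪o {G : TPoset T // (t.1 : TPoset T) ≤ G} :=
    OrderEmbedding.ofMapLEIff (fun a => ⟨(a.1.1 : TPoset T), WithTop.coe_le_coe.2 a.2⟩)
      (fun a b => WithTop.coe_le_coe)
  have hr : ∀ x, x ∈ Set.range ι ↔ ¬ IsTop x := by
    rintro ⟨x, hx⟩
    constructor
    · rintro ⟨a, ha⟩ htop
      rw [← ha] at htop
      have h1 : (⊤ : TPoset T) ≤ (a.1.1 : TPoset T) := htop ⟨(⊤ : TPoset T), le_top⟩
      exact absurd (top_le_iff.1 h1) (WithTop.coe_ne_top)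
    · intro htop
      induction x using WithTop.recTopCoe with
      | top => exact absurd (show IsTop _ from fun y => (le_top : y.1 ≤ (⊤ : TPoset T))) htop
      | coe G =>
        have h1 : t.1 ≤ G := WithTop.coe_le_coe.1 hx
        exact ⟨⟨⟨G, t.2.mono h1⟩, h1⟩, rfl⟩
  obtain ⟨γ, hγ⟩ := descend ι (fun x hx => Or.inr (by rw [hr] at hx; exact not_not.1 hx))
    (fun γ x => by rw [hr, hr, isTop_iso]) (hvert t.1 htT)
    (φ := fun i => (⟨Φ i, hΦ i⟩ : Set.Ici t)) (ψ := fun i => (⟨Ψ i, hΨ i⟩ : Set.Ici t))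
    (fun i j hij => Φ.2 hij) (fun i j hij => Ψ.2 hij)
    ((tri hT he).maxChain_sub _ Φ hΦ) ((tri hT he).maxChain_sub _ Ψ hΨ)
  refine (tri hT he).reg_of_iso (Set.Ici t) γ _ hΦ (fun i => congrArg Subtype.val (hγ i)) ?_ hg hfix
  intro Ω hΩ k hk i
  have h1 : (tri hT he).r k Ω 0 = Ω 0 := (tri hT he).adj_apply Ω (Ne.symm hk)
  exact (Set.mem_Ici.1 (hΩ 0)).trans (h1.ge.trans (((tri hT he).r k Ω).2.monotone (Fin.zero_le i)))

lemma main_pos (he2 : e ≠ 2) (he : 1 ≤ e) (hT : IsLFCTiling T)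
    (htile : ∀ F : TFace T, F.1 ∈ T →
      MaxChainTransitive {G : TPoset T // G ≤ (F : TPoset T)})
    (hvert : ∀ v : TFace T, setRank v.1 = 0 →
      MaxChainTransitive {G : TPoset T // (v : TPoset T) ≤ G}) :
    MaxChainTransitive (TPoset T) := by
  have H : (tri hT he).Reg := ⟨he2, reg_tile hT he htile, reg_vert hT he hvert⟩
  let ι : NF T ↪o TPoset T := OrderEmbedding.ofMapLEIff (fun a => (a.1 : TPoset T))
      (fun a b => WithTop.coe_le_coe)
  have hcmp : ∀ x ∉ Set.range ι, IsBot x ∨ IsTop x := by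
    intro x hx
    induction x using WithTop.recTopCoe with
    | top => exact Or.inr fun y => le_top
    | coe G =>
      left
      have hG : ¬ G.1.Nonempty := fun hG => hx ⟨⟨G, hG⟩, rfl⟩
      intro y
      induction y using WithTop.recTopCoe with
      | top => exact le_top
      | coe H =>
        refine WithTop.coe_le_coe.2 (show G.1 ⊆ H.1 from ?_)
        rw [Set.not_nonempty_iff_eq_empty.1 hG]
        exact Set.empty_subset _
  intro Φ Ψ
  obtain ⟨h1, h2⟩ := chain_of_flag ι hcmp Φ
  obtain ⟨h3, h4⟩ := chain_of_flag ι hcmp Ψ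
  obtain ⟨φ, hφ⟩ := (tri hT he).flag_of_maxChain h1
  obtain ⟨ψ, hψ⟩ := (tri hT he).flag_of_maxChain h3
  obtain ⟨γ, hγ⟩ := Tri.transitive H φ ψ
  obtain ⟨f, hf1, hf2⟩ := extend_iso ι hcmp γ
  refine ⟨f, ?_⟩
  rw [h2, h4, hφ, hψ, Set.image_union]
  congr 1
  · rw [← Set.range_comp, ← Set.range_comp, ← Set.range_comp]
    congr 1
    funext k
    show f (ι (φ k)) = ι (ψ k)
    rw [hf1, hγ]
  · ext x
    constructor
    · rintro ⟨y, hy, rfl⟩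
      rwa [hf2 y hy]
    · intro hx
      exact ⟨x, hx, hf2 x hx⟩

lemma main_zero (T : Set (Set (EucSp 0))) : MaxChainTransitive (TPoset T) := by
  have htot : ∀ x y : TPoset T, x ≤ y ∨ y ≤ x := by
    intro x y
    induction x using WithTop.recTopCoe with
    | top => exact Or.inr le_top
    | coe F =>
      induction y using WithTop.recTopCoe with
      | top => exact Or.inl le_top
      | coe G =>
        rcases Set.eq_empty_or_nonempty F.1 with h | h
        · left
          refine WithTop.coe_le_coe.2 (show F.1 ⊆ G.1 from ?_)
          rw [h]
          exact Set.empty_subset _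
        · right
          refine WithTop.coe_le_coe.2 (show G.1 ⊆ F.1 from ?_)
          rw [Subsingleton.eq_univ_of_nonempty h]
          exact Set.subset_univ _
  have huniv : ∀ Φ : Flag (TPoset T), (Φ : Set (TPoset T)) = Set.univ := fun Φ =>
    Φ.max_chain' (fun x _ y _ _ => htot x y) (Set.subset_univ _)
  intro Φ Ψ
  refine ⟨OrderIso.refl _, ?_⟩
  rw [huniv Φ, huniv Ψ]
  simp

end LFC

/-- An LFC tiling of `ℝ^e`, `e ≠ 2`, all of whose tiles and vertex
figures are combinatorially regular, is itself combinatorially regular. -/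
theorem comb_regular_tiles_and_vertex_figures {e : ℕ} (he : e ≠ 2)
    (T : Set (Set (EucSp e))) (hT : IsLFCTiling T)
    (htile : ∀ F : TFace T, F.1 ∈ T →
      MaxChainTransitive {G : TPoset T // G ≤ (F : TPoset T)})
    (hvert : ∀ v : TFace T, setRank v.1 = 0 →
      MaxChainTransitive {G : TPoset T // (v : TPoset T) ≤ G}) :
    MaxChainTransitive (TPoset T) := by
  rcases Nat.eq_zero_or_pos e with h | h
  · subst h
    exact LFC.main_zero T
  · exact LFC.main_pos he h hT htile hvert
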